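/- arXiv:1109.5020 — 4 statements merged into one kernel-verified Lean document; each statement's English description precedes it below -/
import Mathlib

section
/- Let k ≥ 0 and N = 2. Then γ_{1,k} = 0; that is, for every δ > 0 there exists a ∈ Γ_k (in particular a ∈ L^q(B_1) for some q ∈ (1,∞]) with ‖a − μ_k‖_{L^1(B_1)} < δ. -/
open MeasureTheory Set Filter

noncomputable section

/-- The measure of the (N-1)-dimensional unit sphere in `ℝ^N`. -/
def omegaN (N : ℕ) : ℝ :=
  N * (volume (Metric.ball (0 : EuclideanSpace ℝ (Fin N)) 1)).toReal

/-- `u` is a radial Neumann solution of `Δu + a u = 0` on the unit ball of `ℝ^N`,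
with explicit derivative function `u'` : `u` is continuous on `[0,1]`, differentiable on
`(0,1]`, satisfies the integrated radial equation
`r^(N-1) u'(r) = -∫_0^r s^(N-1) a(s) u(s) ds` on `(0,1]`, and `u'(1) = 0`. -/
def IsRadialNeumannSolutionDeriv (N : ℕ) (a u u' : ℝ → ℝ) : Prop :=
  ContinuousOn u (Icc 0 1) ∧
  (∀ r ∈ Ioc (0:ℝ) 1, HasDerivAt u (u' r) r) ∧
  (∀ r ∈ Ioc (0:ℝ) 1,
    r ^ (N - 1) * u' r = - ∫ s in (0:ℝ)..r, s ^ (N - 1) * a s * u s) ∧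
  u' 1 = 0

/-- `u` is a radial Neumann solution of `Δu + a u = 0` on the unit ball of `ℝ^N`. -/
def IsRadialNeumannSolution (N : ℕ) (a u : ℝ → ℝ) : Prop :=
  ∃ u' : ℝ → ℝ, IsRadialNeumannSolutionDeriv N a u u'

/-- `u` is not identically zero on `[0,1]`. -/
def NontrivialSol (u : ℝ → ℝ) : Prop := ∃ r ∈ Icc (0:ℝ) 1, u r ≠ 0

/-- `μ ≺ a` : `a(r) ≥ μ` for a.e. `r ∈ (0,1)` and `a(r) > μ` on a set of positive measure. -/
def Prec (μ : ℝ) (a : ℝ → ℝ) : Prop :=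
  (∀ᵐ r ∂(volume.restrict (Ioo (0:ℝ) 1)), μ ≤ a r) ∧
  0 < volume {r ∈ Ioo (0:ℝ) 1 | μ < a r}

/-- A radial function `a` belongs to `L^p(B_1)` (finite `p`). -/
def RadialMemLp (N : ℕ) (p : ℝ) (a : ℝ → ℝ) : Prop :=
  IntegrableOn (fun r => r ^ (N - 1) * |a r| ^ p) (Ioo (0:ℝ) 1)

/-- A radial function `a` belongs to `L^∞(B_1)`. -/
def RadialMemLinfty (a : ℝ → ℝ) : Prop :=
  ∃ C : ℝ, ∀ᵐ r ∂(volume.restrict (Ioo (0:ℝ) 1)), |a r| ≤ C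

/-- The `L^p(B_1)` norm of a radial function (finite `p`):
`(ω_N ∫_0^1 r^(N-1) |a(r)|^p dr)^(1/p)`. -/
def radialLpNorm (N : ℕ) (p : ℝ) (a : ℝ → ℝ) : ℝ :=
  (omegaN N * ∫ r in (0:ℝ)..1, r ^ (N - 1) * |a r| ^ p) ^ (1 / p)

/-- The `L^∞(B_1)` norm of a radial function: essential supremum of `|a|` on `(0,1)`. -/
def radialLinftyNorm (a : ℝ → ℝ) : ℝ :=
  essSup (fun r => |a r|) (volume.restrict (Ioo (0:ℝ) 1))

/-- The admissible class `Γ_k` at level `μk`: radial measurable `a` with `μk ≺ a`, such that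
`Δu + a u = 0` has a nontrivial radial Neumann solution, and `a ∈ L^{N/2}(B_1)` if `N ≥ 3`,
or `a ∈ L^q(B_1)` for some `q ∈ (1,∞]` if `N = 2`. -/
def GammaSet (N : ℕ) (μk : ℝ) (a : ℝ → ℝ) : Prop :=
  Measurable a ∧ Prec μk a ∧
  (∃ u : ℝ → ℝ, IsRadialNeumannSolution N a u ∧ NontrivialSol u) ∧
  (if 3 ≤ N then RadialMemLp N ((N : ℝ) / 2) a
   else (∃ q : ℝ, 1 < q ∧ RadialMemLp N q a) ∨ RadialMemLinfty a)

/-- The Lyapunov constant `γ_{p,k}` for finite `p`. -/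
def gammaLyap (N : ℕ) (μk : ℝ) (p : ℝ) : ℝ :=
  sInf {t : ℝ | ∃ a : ℝ → ℝ, GammaSet N μk a ∧ RadialMemLp N p a ∧
    t = radialLpNorm N p (fun r => a r - μk)}

/-- The Lyapunov constant `γ_{∞,k}`. -/
def gammaLyapInfty (N : ℕ) (μk : ℝ) : ℝ :=
  sInf {t : ℝ | ∃ a : ℝ → ℝ, GammaSet N μk a ∧ RadialMemLinfty a ∧
    t = radialLinftyNorm (fun r => a r - μk)}

/-- `(μ, φ)` is the `k`-th radial Neumann eigenpair of `-Δ` on `B_1 ⊆ ℝ^N`: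
`μ ≥ 0`, `φ` is a nontrivial radial Neumann solution of `Δφ + μ φ = 0` having exactly `k`
zeros in `(0,1)`, all simple, given by `rz k < rz (k-1) < ⋯ < rz 1`. -/
def IsRadialNeumannEigenpair (N k : ℕ) (μ : ℝ) (φ : ℝ → ℝ) (rz : ℕ → ℝ) : Prop :=
  0 ≤ μ ∧
  IsRadialNeumannSolution N (fun _ => μ) φ ∧ NontrivialSol φ ∧
  (∀ i, 1 ≤ i → i ≤ k → rz i ∈ Ioo (0:ℝ) 1) ∧
  (∀ i j, 1 ≤ i → i < j → j ≤ k → rz j < rz i) ∧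
  (∀ x ∈ Ioo (0:ℝ) 1, (φ x = 0 ↔ ∃ i, 1 ≤ i ∧ i ≤ k ∧ x = rz i)) ∧
  (∀ i, 1 ≤ i → i ≤ k → ∃ d : ℝ, d ≠ 0 ∧ HasDerivAt φ d (rz i))

/-- `u` (with derivative `u'`) is a radial `H^1` solution of `Δu + a u = 0` in `B_1`:
continuous on `(0,1]`, differentiable on `(0,1)`, satisfying the integrated radial equation
between any two radii, with finite radial `H^1` energy. -/
def IsRadialH1Solution (N : ℕ) (a u u' : ℝ → ℝ) : Prop :=
  ContinuousOn u (Ioc 0 1) ∧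
  (∀ r ∈ Ioo (0:ℝ) 1, HasDerivAt u (u' r) r) ∧
  (∀ s ∈ Ioo (0:ℝ) 1, ∀ r ∈ Ioo (0:ℝ) 1, s < r →
    r ^ (N - 1) * u' r - s ^ (N - 1) * u' s
      = - ∫ t in s..r, t ^ (N - 1) * a t * u t) ∧
  IntegrableOn (fun r => r ^ (N - 1) * ((u' r) ^ 2 + (u r) ^ 2)) (Ioo (0:ℝ) 1)

/-- The Sobolev quotient: infimum of `(∫_{B_ρ} |∇w|²) / (∫_{B_ρ} |w|^q)^{2/q}` over nontrivial
`C^1` functions `w : ℝ^N → ℝ` with compact support contained in the ball `B_ρ`. -/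
def sobolevQuot (N : ℕ) (q : ℝ) (ρ : ℝ) : ℝ :=
  sInf {t : ℝ | ∃ w : EuclideanSpace ℝ (Fin N) → ℝ,
    ContDiff ℝ 1 w ∧ (∃ x, w x ≠ 0) ∧ tsupport w ⊆ Metric.ball 0 ρ ∧
    t = (∫ x in Metric.ball (0 : EuclideanSpace ℝ (Fin N)) ρ, ‖fderiv ℝ w x‖ ^ 2) /
        (∫ x in Metric.ball (0 : EuclideanSpace ℝ (Fin N)) ρ, |w x| ^ q) ^ (2 / q)}

/-- The cosine of the truncation of `x` to `[0, π]`. -/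
def clippedCos (x : ℝ) : ℝ := Real.cos (max 0 (min Real.pi x))

/-- The sine of the truncation of `x` to `[0, π]`. -/
def clippedSin (x : ℝ) : ℝ := Real.sin (max 0 (min Real.pi x))

theorem continuous_clippedCos : Continuous clippedCos := by
  unfold clippedCos; fun_prop

theorem continuous_clippedSin : Continuous clippedSin := by
  unfold clippedSin; fun_prop

theorem clippedCos_of_nonpos {x : ℝ} (hx : x ≤ 0) : clippedCos x = 1 := by
  unfold clippedCos
  rw [max_eq_left ((min_le_right _ _).trans hx), Real.cos_zero]

theorem clippedSin_of_nonpos {x : ℝ} (hx : x ≤ 0) : clippedSin x = 0 := by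
  unfold clippedSin
  rw [max_eq_left ((min_le_right _ _).trans hx), Real.sin_zero]

theorem clippedCos_of_pi_le {x : ℝ} (hx : Real.pi ≤ x) : clippedCos x = -1 := by
  unfold clippedCos
  rw [min_eq_left hx, max_eq_right Real.pi_pos.le, Real.cos_pi]

theorem clippedSin_of_pi_le {x : ℝ} (hx : Real.pi ≤ x) : clippedSin x = 0 := by
  unfold clippedSin
  rw [min_eq_left hx, max_eq_right Real.pi_pos.le, Real.sin_pi]

theorem clippedCos_of_mem {x : ℝ} (hx : x ∈ Icc 0 Real.pi) : clippedCos x = Real.cos x := by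
  unfold clippedCos
  rw [min_eq_right hx.2, max_eq_right hx.1]

theorem clippedSin_of_mem {x : ℝ} (hx : x ∈ Icc 0 Real.pi) : clippedSin x = Real.sin x := by
  unfold clippedSin
  rw [min_eq_right hx.2, max_eq_right hx.1]

theorem hasDerivAt_clippedSin {x : ℝ} (hx : x ∈ Ioo 0 Real.pi) :
    HasDerivAt clippedSin (clippedCos x) x := by
  rw [clippedCos_of_mem (Ioo_subset_Icc_self hx)]
  refine (Real.hasDerivAt_sin x).congr_of_eventuallyEq ?_
  filter_upwards [Ioo_mem_nhds hx.1 hx.2] with y hy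
  exact clippedSin_of_mem (Ioo_subset_Icc_self hy)

theorem hasDerivAt_clippedCos (x : ℝ) : HasDerivAt clippedCos (-clippedSin x) x := by
  have off : ∀ y, y ≠ 0 → y ≠ Real.pi → HasDerivAt clippedCos (-clippedSin y) y := by
    intro y h0 hpi
    rcases lt_or_gt_of_ne h0 with h | h
    · rw [clippedSin_of_nonpos h.le, neg_zero]
      refine (hasDerivAt_const y (1 : ℝ)).congr_of_eventuallyEq ?_
      filter_upwards [Iio_mem_nhds h] with z hz
      exact clippedCos_of_nonpos (le_of_lt hz)
    rcases lt_or_gt_of_ne hpi with h' | h'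
    · rw [clippedSin_of_mem ⟨h.le, h'.le⟩]
      refine (Real.hasDerivAt_cos y).congr_of_eventuallyEq ?_
      filter_upwards [Ioo_mem_nhds h h'] with z hz
      exact clippedCos_of_mem (Ioo_subset_Icc_self hz)
    · rw [clippedSin_of_pi_le h'.le, neg_zero]
      refine (hasDerivAt_const y (-1 : ℝ)).congr_of_eventuallyEq ?_
      filter_upwards [Ioi_mem_nhds h'] with z hz
      exact clippedCos_of_pi_le (le_of_lt hz)
  have key : ∀ p, (p = 0 ∨ p = Real.pi) → HasDerivAt clippedCos (-clippedSin p) p := by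
    intro p hp
    have hlt : ∀ᶠ y in nhdsWithin p {p}ᶜ, HasDerivAt clippedCos (-clippedSin y) y := by
      have h0 : ∀ᶠ y in nhdsWithin p {p}ᶜ, y ≠ 0 := by
        rcases hp with rfl | rfl
        · exact self_mem_nhdsWithin
        · exact nhdsWithin_le_nhds (isOpen_ne.mem_nhds Real.pi_ne_zero)
      have hpi : ∀ᶠ y in nhdsWithin p {p}ᶜ, y ≠ Real.pi := by
        rcases hp with rfl | rfl
        · exact nhdsWithin_le_nhds (isOpen_ne.mem_nhds Real.pi_ne_zero.symm)
        · exact self_mem_nhdsWithin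
      filter_upwards [h0, hpi] with y using off y
    have hc : Tendsto (fun y => -clippedSin y) (nhds p) (nhds (-clippedSin p)) :=
      continuous_clippedSin.neg.continuousAt
    have hd : Tendsto (deriv clippedCos) (nhdsWithin p {p}ᶜ) (nhds (-clippedSin p)) :=
      (hc.mono_left nhdsWithin_le_nhds).congr' (hlt.mono fun y hy => hy.deriv.symm)
    have hsplit : ∀ {s : Set ℝ}, s ⊆ {p}ᶜ → nhdsWithin p s ≤ nhdsWithin p {p}ᶜ :=
      fun h => nhdsWithin_mono p h
    have hl : Iio p ⊆ {p}ᶜ := fun y hy => ne_of_lt hy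
    have hr : Ioi p ⊆ {p}ᶜ := fun y hy => ne_of_gt hy
    obtain ⟨l, hlp, hL⟩ := mem_nhdsLT_iff_exists_Ioo_subset.1 (hlt.filter_mono (hsplit hl))
    obtain ⟨r, hrp, hR⟩ := mem_nhdsGT_iff_exists_Ioo_subset.1 (hlt.filter_mono (hsplit hr))
    have A := hasDerivWithinAt_Iic_of_tendsto_deriv (s := Ioo l p)
      (fun y hy => (hL hy).differentiableAt.differentiableWithinAt)
      continuous_clippedCos.continuousWithinAt (Ioo_mem_nhdsLT hlp) (hd.mono_left (hsplit hl))
    have B := hasDerivWithinAt_Ici_of_tendsto_deriv (s := Ioo p r)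
      (fun y hy => (hR hy).differentiableAt.differentiableWithinAt)
      continuous_clippedCos.continuousWithinAt (Ioo_mem_nhdsGT hrp) (hd.mono_left (hsplit hr))
    simpa using A.union B
  by_cases hx : x = 0 ∨ x = Real.pi
  · exact key x hx
  · push Not at hx
    exact off x hx.1 hx.2

/-- The density `1 / (r φ(r)²)`, with `r` truncated to `[α, β]`. -/
def annulusWeight (φ : ℝ → ℝ) (α β r : ℝ) : ℝ :=
  (max α (min β r) * φ (max α (min β r)) ^ 2)⁻¹

/-- The integral of `1 / (r φ(r)²)` over `[α, β]`. -/
def annulusMass (φ : ℝ → ℝ) (α β : ℝ) : ℝ := ∫ r in α..β, annulusWeight φ α β r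

/-- The potential supported in the annulus `α < r < β` that allows for one more zero. -/
def annulusPotential (φ : ℝ → ℝ) (α β : ℝ) : ℝ → ℝ :=
  (Ioo α β).indicator fun r => (Real.pi / annulusMass φ α β * annulusWeight φ α β r) ^ 2

section Annulus

variable {φ : ℝ → ℝ} {α β : ℝ}

theorem clamp_mem (hαβ : α < β) (r : ℝ) : max α (min β r) ∈ Icc α β :=
  ⟨le_max_left _ _, max_le hαβ.le (min_le_left _ _)⟩

theorem clamp_of_mem {r : ℝ} (hr : r ∈ Icc α β) : max α (min β r) = r := by
  rw [min_eq_right hr.2, max_eq_right hr.1]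

theorem continuous_comp_clamp (hαβ : α < β) (hc : ContinuousOn φ (Icc α β)) :
    Continuous fun r => φ (max α (min β r)) :=
  hc.comp_continuous (by fun_prop) (clamp_mem hαβ)

theorem continuous_annulusWeight (hα : 0 < α) (hαβ : α < β) (hc : ContinuousOn φ (Icc α β))
    (hne : ∀ r ∈ Icc α β, φ r ≠ 0) : Continuous (annulusWeight φ α β) := by
  have h := continuous_comp_clamp hαβ hc
  unfold annulusWeight
  refine Continuous.inv₀ (Continuous.mul (by fun_prop) (h.pow 2)) fun r => ?_
  have hr := clamp_mem hαβ r
  exact mul_ne_zero (hα.trans_le hr.1).ne' (pow_ne_zero 2 (hne _ hr))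

theorem annulusWeight_pos (hα : 0 < α) (hαβ : α < β)
    (hne : ∀ r ∈ Icc α β, φ r ≠ 0) (r : ℝ) : 0 < annulusWeight φ α β r := by
  have hr := clamp_mem hαβ r
  have := hα.trans_le hr.1
  have := hne _ hr
  unfold annulusWeight
  positivity

theorem annulusMass_pos (hα : 0 < α) (hαβ : α < β) (hc : ContinuousOn φ (Icc α β))
    (hne : ∀ r ∈ Icc α β, φ r ≠ 0) : 0 < annulusMass φ α β :=
  intervalIntegral.intervalIntegral_pos_of_pos
    ((continuous_annulusWeight hα hαβ hc hne).intervalIntegrable _ _)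
    (annulusWeight_pos hα hαβ hne) hαβ

theorem measurable_annulusPotential (hα : 0 < α) (hαβ : α < β) (hc : ContinuousOn φ (Icc α β))
    (hne : ∀ r ∈ Icc α β, φ r ≠ 0) : Measurable (annulusPotential φ α β) :=
  ((continuous_const.mul (continuous_annulusWeight hα hαβ hc hne)).pow 2).measurable.indicator
    measurableSet_Ioo

theorem annulusPotential_nonneg (r : ℝ) : 0 ≤ annulusPotential φ α β r :=
  indicator_nonneg (fun _ _ => sq_nonneg _) r

theorem exists_annulusPotential_le (hα : 0 < α) (hαβ : α < β) (hc : ContinuousOn φ (Icc α β))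
    (hne : ∀ r ∈ Icc α β, φ r ≠ 0) : ∃ C, ∀ r, annulusPotential φ α β r ≤ C := by
  obtain ⟨C, hC⟩ := isCompact_Icc.exists_bound_of_continuousOn (s := Icc α β)
    ((continuous_const (y := Real.pi / annulusMass φ α β)).mul
      (continuous_annulusWeight hα hαβ hc hne)).continuousOn
  refine ⟨C ^ 2, fun r => indicator_le' ?_ (fun _ _ => sq_nonneg C) r⟩
  intro r hr
  have := hC r (Ioo_subset_Icc_self hr)
  rw [← sq_abs]
  exact pow_le_pow_left₀ (abs_nonneg _) this 2

/-- Adding the annulus potential to `μ` preserves solvability of the radial Neumann problem. -/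
theorem exists_solution_add_annulusPotential {μ : ℝ} (hφ : IsRadialNeumannSolution 2 (fun _ => μ) φ)
    (hα : 0 < α) (hαβ : α < β) (hβ : β < 1) (hne : ∀ r ∈ Icc α β, φ r ≠ 0) :
    ∃ u, IsRadialNeumannSolution 2 (fun r => μ + annulusPotential φ α β r) u ∧
      NontrivialSol u := by
  obtain ⟨φ', hcont, hder, heq, hφ'1⟩ := hφ
  have hsub : Icc α β ⊆ Icc (0:ℝ) 1 := Icc_subset_Icc hα.le hβ.le
  have hc : ContinuousOn φ (Icc α β) := hcont.mono hsub
  have hq := continuous_annulusWeight hα hαβ hc hne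
  have hqpos := annulusWeight_pos hα hαβ hne
  have hT := annulusMass_pos hα hαβ hc hne
  set q := annulusWeight φ α β with hqdef
  set m := Real.pi / annulusMass φ α β with hm
  have hmpos : 0 < m := div_pos Real.pi_pos hT
  set θ : ℝ → ℝ := fun r => m * ∫ s in r..β, q s with hθ
  have hθd : ∀ r, HasDerivAt θ (-(m * q r)) r := fun r => by
    have := (intervalIntegral.integral_hasDerivAt_left (hq.intervalIntegrable r β)
      hq.aestronglyMeasurable.stronglyMeasurableAtFilter hq.continuousAt).const_mul m
    simpa using this
  have hθanti : StrictAnti θ := strictAnti_of_hasDerivAt_neg hθd fun r => by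
    have := mul_pos hmpos (hqpos r)
    linarith
  have hθc : Continuous θ := continuous_iff_continuousAt.2 fun r => (hθd r).continuousAt
  have hθβ : θ β = 0 := by simp [hθ]
  have hθα : θ α = Real.pi := div_mul_cancel₀ _ hT.ne'
  have hWd : ∀ r, HasDerivAt (fun r => clippedCos (θ r)) (clippedSin (θ r) * (m * q r)) r :=
    fun r => by
      have := (hasDerivAt_clippedCos (θ r)).comp r (hθd r)
      simpa [Function.comp_def] using this
  have hWc : Continuous fun r => clippedCos (θ r) := continuous_clippedCos.comp hθc
  have hSc : Continuous fun r => clippedSin (θ r) := continuous_clippedSin.comp hθc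
  have hSzero : ∀ r, r ∉ Ioo α β → clippedSin (θ r) = 0 := by
    intro r hr
    rcases le_or_gt r α with h | h
    · exact clippedSin_of_pi_le (hθα ▸ hθanti.antitone h)
    · have : β ≤ r := by
        by_contra hlt
        exact hr ⟨h, not_le.1 hlt⟩
      exact clippedSin_of_nonpos (hθβ ▸ hθanti.antitone this)
  have hsφ : ContinuousOn (fun s => s * μ * φ s) (Icc 0 1) := by fun_prop
  have hsφi : ∀ r ∈ Icc (0:ℝ) 1, IntervalIntegrable (fun s => s * μ * φ s) volume 0 r :=
    fun r hr => (hsφ.mono (by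
      rw [uIcc_of_le hr.1]; exact Icc_subset_Icc_right hr.2)).intervalIntegrable
  set G : ℝ → ℝ := fun r => -∫ s in (0:ℝ)..r, s * μ * φ s with hG
  have hGeq : ∀ r ∈ Ioc (0:ℝ) 1, r * φ' r = G r := fun r hr => by simpa using heq r hr
  have hGc : ContinuousOn G (Icc 0 1) := by
    have := intervalIntegral.continuousOn_primitive_interval (f := fun s => s * μ * φ s)
      (μ := volume) (a := 0) (b := 1) (by
        rw [uIcc_of_le zero_le_one]; exact hsφ.integrableOn_Icc)
    rw [uIcc_of_le zero_le_one] at this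
    exact this.neg
  have hGd : ∀ r ∈ Ioo (0:ℝ) 1, HasDerivAt G (-(r * μ * φ r)) r := fun r hr =>
    (intervalIntegral.integral_hasDerivAt_right (hsφi r (Ioo_subset_Icc_self hr))
      (hsφ.mono Ioo_subset_Icc_self |>.stronglyMeasurableAtFilter isOpen_Ioo r hr)
      (hsφ.continuousAt (Icc_mem_nhds hr.1 hr.2))).neg
  set P : ℝ → ℝ := fun r => φ (max α (min β r)) with hP
  have hPc : Continuous P := continuous_comp_clamp hαβ hc
  have hPne : ∀ r, P r ≠ 0 := fun r => hne _ (clamp_mem hαβ r)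
  set F : ℝ → ℝ := fun r => G r * clippedCos (θ r) + m * clippedSin (θ r) / P r with hF
  have hFc : ContinuousOn F (Icc 0 1) :=
    (hGc.mul hWc.continuousOn).add
      ((continuous_const.mul hSc).div hPc hPne).continuousOn
  have hFd : ∀ r ∈ Ioo (0:ℝ) 1, r ≠ α → r ≠ β → HasDerivAt F
      (-(r * (μ + annulusPotential φ α β r) * (φ r * clippedCos (θ r)))) r := by
    intro r hr hrα hrβ
    have h1 := (hGd r hr).mul (hWd r)
    by_cases hmem : r ∈ Ioo α β
    · have hmem' := Ioo_subset_Icc_self hmem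
      have hPr : P r = φ r := by simp only [hP, clamp_of_mem hmem']
      have hPd : HasDerivAt P (φ' r) r := by
        refine (hder r (Ioo_subset_Ioc_self hr)).congr_of_eventuallyEq ?_
        filter_upwards [Ioo_mem_nhds hmem.1 hmem.2] with s hs
        simp only [hP, clamp_of_mem (Ioo_subset_Icc_self hs)]
      have hθr : θ r ∈ Ioo 0 Real.pi :=
        ⟨hθβ ▸ hθanti hmem.2, hθα ▸ hθanti hmem.1⟩
      have h2 := (((hasDerivAt_clippedSin hθr).comp r (hθd r)).const_mul m).div hPd (hPne r)
      refine (h1.add h2).congr_deriv ?_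
      have hqr : q r = (r * φ r ^ 2)⁻¹ := by
        simp only [hqdef, annulusWeight, clamp_of_mem hmem']
      have hφr : φ r ≠ 0 := hne r hmem'
      have hr0 : r ≠ 0 := hr.1.ne'
      simp only [annulusPotential, indicator_of_mem hmem, Function.comp_apply, hPr, ← hqdef, ← hm,
        ← hGeq r (Ioo_subset_Ioc_self hr), hqr]
      field_simp
      ring
    · have hnhds : (Icc α β)ᶜ ∈ nhds r := isClosed_Icc.isOpen_compl.mem_nhds fun h =>
        hmem ⟨lt_of_le_of_ne h.1 hrα.symm, lt_of_le_of_ne h.2 hrβ⟩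
      have hFG : F =ᶠ[nhds r] fun r => G r * clippedCos (θ r) := by
        filter_upwards [hnhds] with s hs
        simp [hF, hSzero s fun h => hs (Ioo_subset_Icc_self h)]
      refine HasDerivAt.congr_of_eventuallyEq ?_ hFG
      refine h1.congr_deriv ?_
      simp only [annulusPotential, indicator_of_notMem hmem, hSzero r hmem]
      ring
  obtain ⟨C, hC⟩ := exists_annulusPotential_le hα hαβ hc hne
  have hint : IntegrableOn (fun r => -(r * (μ + annulusPotential φ α β r) *
      (φ r * clippedCos (θ r)))) (Icc 0 1) := by
    have hb : IntegrableOn (fun r => μ + annulusPotential φ α β r) (Icc 0 1) := by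
      refine Measure.integrableOn_of_bounded (M := |μ| + C) (by simp)
        ((measurable_annulusPotential hα hαβ hc hne).const_add μ).aestronglyMeasurable ?_
      refine ae_of_all _ fun r => (abs_add_le _ _).trans ?_
      rw [abs_of_nonneg (annulusPotential_nonneg r)]
      exact add_le_add_right (hC r) _
    have hg : ContinuousOn (fun r => -(r * (φ r * clippedCos (θ r)))) (Icc 0 1) := by
      have := hWc.continuousOn (s := Icc (0:ℝ) 1)
      fun_prop
    refine (hb.continuousOn_mul hg isCompact_Icc).congr_fun (fun r _ => ?_) measurableSet_Icc
    ring
  refine ⟨fun r => φ r * clippedCos (θ r),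
    ⟨fun r => φ' r * clippedCos (θ r) + φ r * (clippedSin (θ r) * (m * q r)),
      hcont.mul hWc.continuousOn, fun r hr => (hder r hr).mul (hWd r), fun r hr => ?_, ?_⟩,
    α, ⟨hα.le, hαβ.le.trans hβ.le⟩, ?_⟩
  · have hFTC := integral_eq_of_hasDerivAt_off_countable_of_le F _ hr.1.le
      (s := {α, β}) (Set.toFinite _).countable (hFc.mono (Icc_subset_Icc_right hr.2))
      (fun x hx => hFd x ⟨hx.1.1, hx.1.2.trans_le hr.2⟩ (fun h => hx.2 (by simp [h]))
        (fun h => hx.2 (by simp [h])))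
      ((hint.mono_set (by
        rw [uIcc_of_le hr.1.le]; exact Icc_subset_Icc_right hr.2)).intervalIntegrable)
    have hF0 : F 0 = 0 := by
      simp [hF, hG, hSzero 0 fun h => hα.not_gt h.1]
    rw [intervalIntegral.integral_neg, hF0, sub_zero] at hFTC
    simp only [Nat.add_one_sub_one, pow_one]
    rw [hFTC]
    simp only [hF, ← hGeq r hr]
    by_cases hmem : r ∈ Ioo α β
    · have hmem' := Ioo_subset_Icc_self hmem
      have hφr : φ r ≠ 0 := hne r hmem'
      have hr0 : r ≠ 0 := hr.1.ne'
      simp only [hP, hqdef, annulusWeight, clamp_of_mem hmem']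
      field_simp
    · simp only [hSzero r hmem]
      ring
  · simp [hφ'1, hSzero 1 fun h => hβ.not_gt h.2]
  · simpa [hθα, clippedCos_of_pi_le le_rfl] using hne α (left_mem_Icc.2 hαβ.le)

/-- The weighted `L¹` norm of the annulus potential is controlled by the inverse of its mass. -/
theorem integral_annulusPotential_le (hα : 0 < α) (hαβ : α < β) (hβ : β < 1)
    (hc : ContinuousOn φ (Icc α β)) {c : ℝ} (hc0 : 0 < c) (hcφ : ∀ r ∈ Icc α β, c ≤ |φ r|) :
    ∫ r in (0:ℝ)..1, r * annulusPotential φ α β r ≤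
      Real.pi ^ 2 / c ^ 2 / annulusMass φ α β := by
  have hne : ∀ r ∈ Icc α β, φ r ≠ 0 := fun r hr => abs_pos.1 (hc0.trans_le (hcφ r hr))
  have hq := continuous_annulusWeight hα hαβ hc hne
  have hT := annulusMass_pos hα hαβ hc hne
  set m := Real.pi / annulusMass φ α β with hm
  have hind : (fun r => r * annulusPotential φ α β r) =
      (Ioo α β).indicator fun r => r * (m * annulusWeight φ α β r) ^ 2 := by
    funext r
    by_cases hr : r ∈ Ioo α β <;> simp [annulusPotential, hr, hm]
  have hsub : Ioo α β ⊆ Ioc 0 1 := fun r hr => ⟨hα.trans hr.1, (hr.2.trans hβ).le⟩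
  rw [hind, intervalIntegral.integral_of_le zero_le_one, setIntegral_indicator measurableSet_Ioo,
    inter_eq_right.2 hsub, ← integral_Ioc_eq_integral_Ioo, ← intervalIntegral.integral_of_le hαβ.le]
  calc ∫ r in α..β, r * (m * annulusWeight φ α β r) ^ 2
      ≤ ∫ r in α..β, m ^ 2 / c ^ 2 * annulusWeight φ α β r := by
        refine intervalIntegral.integral_mono_on hαβ.le
          (Continuous.intervalIntegrable (by fun_prop) _ _)
          (Continuous.intervalIntegrable (by fun_prop) _ _) fun r hr => ?_
        have hr0 : 0 < r := hα.trans_le hr.1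
        have hcr : c ^ 2 ≤ φ r ^ 2 := by
          rw [← sq_abs (φ r)]
          exact pow_le_pow_left₀ hc0.le (hcφ r hr) 2
        have hφ2 : 0 < φ r ^ 2 := (pow_pos hc0 2).trans_le hcr
        have hw : annulusWeight φ α β r = (r * φ r ^ 2)⁻¹ := by
          simp only [annulusWeight, clamp_of_mem hr]
        have hrw : r * annulusWeight φ α β r ≤ 1 / c ^ 2 := by
          rw [hw, mul_inv, ← mul_assoc, mul_inv_cancel₀ hr0.ne', one_mul, ← one_div]
          exact one_div_le_one_div_of_le (pow_pos hc0 2) hcr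
        have hw0 := (annulusWeight_pos hα hαβ hne r).le
        calc r * (m * annulusWeight φ α β r) ^ 2
            = m ^ 2 * (r * annulusWeight φ α β r) * annulusWeight φ α β r := by ring
          _ ≤ m ^ 2 * (1 / c ^ 2) * annulusWeight φ α β r := by gcongr
          _ = _ := by ring
    _ = m ^ 2 / c ^ 2 * annulusMass φ α β := by
        rw [intervalIntegral.integral_const_mul, annulusMass]
    _ = _ := by
        rw [hm]
        field_simp

theorem log_div_le_annulusMass (hα : 0 < α) (hαβ : α < β) (hc : ContinuousOn φ (Icc α β))
    (hne : ∀ r ∈ Icc α β, φ r ≠ 0) {M : ℝ} (hM : ∀ r ∈ Icc α β, |φ r| ≤ M) :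
    Real.log (β / α) / M ^ 2 ≤ annulusMass φ α β := by
  rw [← integral_inv_of_pos hα (hα.trans hαβ), ← intervalIntegral.integral_div, annulusMass]
  refine intervalIntegral.integral_mono_on hαβ.le ?_
    ((continuous_annulusWeight hα hαβ hc hne).intervalIntegrable _ _) fun r hr => ?_
  · refine (ContinuousOn.div_const (continuousOn_inv₀.mono ?_) _).intervalIntegrable
    rw [uIcc_of_le hαβ.le]
    exact fun r hr => (hα.trans_le hr.1).ne'
  · have hr0 : 0 < r := hα.trans_le hr.1
    have hφ0 := hne r hr
    have hle : φ r ^ 2 ≤ M ^ 2 := by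
      rw [← sq_abs (φ r)]
      exact pow_le_pow_left₀ (abs_nonneg _) (hM r hr) 2
    simp only [annulusWeight, clamp_of_mem hr, mul_inv, div_eq_mul_inv]
    gcongr

end Annulus

/-- A radial Neumann eigenfunction does not vanish at the origin. -/
theorem IsRadialNeumannEigenpair.apply_zero_ne_zero {k : ℕ} {μ : ℝ} {φ : ℝ → ℝ} {rz : ℕ → ℝ}
    (h : IsRadialNeumannEigenpair 2 k μ φ rz) : φ 0 ≠ 0 := by
  obtain ⟨hμ, ⟨φ', hcont, hder, heq, -⟩, -, hrz, -, hzero, -⟩ := h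
  intro h0
  obtain ⟨ε, hε0, hε1, hε⟩ : ∃ ε, 0 < ε ∧ ε < 1 ∧ ∀ i, 1 ≤ i → i ≤ k → ε < rz i := by
    have hev : ∀ᶠ ε in nhdsWithin (0:ℝ) (Ioi 0), ∀ i ∈ Finset.Icc 1 k, ε < rz i := by
      rw [Filter.eventually_all_finset]
      intro i hi
      have hi := Finset.mem_Icc.1 hi
      exact nhdsWithin_le_nhds (Iio_mem_nhds (hrz i hi.1 hi.2).1)
    obtain ⟨ε, ⟨hε, h1⟩, h2⟩ :=
      ((hev.and (nhdsWithin_le_nhds (Iio_mem_nhds one_pos))).and self_mem_nhdsWithin).exists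
    exact ⟨ε, h2, h1, fun i hi hik => hε i (Finset.mem_Icc.2 ⟨hi, hik⟩)⟩
  have hne : ∀ r ∈ Ioc 0 ε, φ r ≠ 0 := fun r hr hr0 => by
    obtain ⟨i, hi, hik, rfl⟩ := (hzero r ⟨hr.1, hr.2.trans_lt hε1⟩).1 hr0
    exact (hε i hi hik).not_ge hr.2
  have hsame : ∀ s ∈ Ioc 0 ε, ∀ r ∈ Ioc 0 ε, 0 ≤ φ s * φ r := by
    intro s hs r hr
    by_contra hneg
    have hconn := isPreconnected_Ioc.image φ
      (hcont.mono fun x (hx : x ∈ Ioc 0 ε) => ⟨hx.1.le, hx.2.trans hε1.le⟩)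
    obtain ⟨x, hx, hx0⟩ : (0:ℝ) ∈ φ '' Ioc 0 ε := by
      rcases mul_neg_iff.1 (not_le.1 hneg) with ⟨h1, h2⟩ | ⟨h1, h2⟩
      · exact hconn.Icc_subset (mem_image_of_mem φ hr) (mem_image_of_mem φ hs) ⟨h2.le, h1.le⟩
      · exact hconn.Icc_subset (mem_image_of_mem φ hs) (mem_image_of_mem φ hr) ⟨h1.le, h2.le⟩
    exact hne x hx hx0
  have hanti : AntitoneOn (fun r => φ r ^ 2) (Icc 0 ε) := by
    refine antitoneOn_of_hasDerivWithinAt_nonpos (convex_Icc 0 ε)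
      (f' := fun r => 2 * φ r * φ' r)
      ((hcont.mono (Icc_subset_Icc_right hε1.le)).pow 2) (fun r hr => ?_) fun r hr => ?_
    · rw [interior_Icc] at hr
      refine HasDerivAt.hasDerivWithinAt ?_
      exact ((hder r ⟨hr.1, (hr.2.trans hε1).le⟩).fun_pow 2).congr_deriv (by norm_num)
    · rw [interior_Icc] at hr
      have heq' := heq r ⟨hr.1, (hr.2.trans hε1).le⟩
      simp only [Nat.add_one_sub_one, pow_one] at heq'
      have hpos : 0 ≤ ∫ s in (0:ℝ)..r, s * μ * φ s * φ r := by
        rw [intervalIntegral.integral_of_le hr.1.le]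
        refine setIntegral_nonneg measurableSet_Ioc fun s hs => ?_
        rw [mul_assoc]
        exact mul_nonneg (mul_nonneg hs.1.le hμ)
          (hsame s ⟨hs.1, hs.2.trans hr.2.le⟩ r (Ioo_subset_Ioc_self hr))
      rw [intervalIntegral.integral_mul_const] at hpos
      have hle : r * (φ r * φ' r) ≤ 0 := by
        calc r * (φ r * φ' r) = r * φ' r * φ r := by ring
          _ ≤ 0 := by rw [heq']; linarith
      have := nonpos_of_mul_nonpos_right hle hr.1
      linarith
  have hle := hanti (left_mem_Icc.2 hε0.le) (right_mem_Icc.2 hε0.le) hε0.le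
  simp only [h0, ne_eq, OfNat.ofNat_ne_zero, not_false_eq_true, zero_pow] at hle
  exact hne ε ⟨hε0, le_rfl⟩ (pow_eq_zero_iff two_ne_zero |>.1 (le_antisymm hle (sq_nonneg _)))

theorem radialLpNorm_two_one (a : ℝ → ℝ) :
    radialLpNorm 2 1 a = omegaN 2 * ∫ r in (0:ℝ)..1, r * |a r| := by
  simp [radialLpNorm]

theorem omegaN_nonneg (N : ℕ) : 0 ≤ omegaN N :=
  mul_nonneg N.cast_nonneg ENNReal.toReal_nonneg

theorem radialLpNorm_nonneg (N : ℕ) (p : ℝ) (a : ℝ → ℝ) : 0 ≤ radialLpNorm N p a := by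
  refine Real.rpow_nonneg (mul_nonneg (omegaN_nonneg N) ?_) _
  refine intervalIntegral.integral_nonneg zero_le_one fun r hr => ?_
  have := hr.1
  positivity

/-- If `φ` does not vanish at the origin, then `μ` has arbitrarily small admissible perturbations
in `L¹` of the planar disc. -/
theorem exists_gammaSet_radialLpNorm_lt {μ : ℝ} {φ : ℝ → ℝ}
    (hφ : IsRadialNeumannSolution 2 (fun _ => μ) φ) (h0 : φ 0 ≠ 0) {δ : ℝ} (hδ : 0 < δ) :
    ∃ a : ℝ → ℝ, GammaSet 2 μ a ∧ RadialMemLp 2 1 a ∧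
      radialLpNorm 2 1 (fun r => a r - μ) < δ := by
  have hcont : ContinuousOn φ (Icc 0 1) := hφ.choose_spec.1
  have hφ0 : 0 < |φ 0| := abs_pos.2 h0
  obtain ⟨β, hβ0, hβ1, hlow, hup⟩ : ∃ β, 0 < β ∧ β < 1 ∧
      (∀ r ∈ Icc 0 β, |φ 0| / 2 ≤ |φ r|) ∧ ∀ r ∈ Icc 0 β, |φ r| ≤ 2 * |φ 0| := by
    have ht : Tendsto (fun r => |φ r|) (nhdsWithin 0 (Icc 0 1)) (nhds |φ 0|) :=
      (hcont 0 (left_mem_Icc.2 zero_le_one)).abs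
    rw [nhdsWithin_Icc_eq_nhdsGE one_pos] at ht
    have hev := ht.eventually (Ioo_mem_nhds (half_lt_self hφ0) (show |φ 0| < 2 * |φ 0| by linarith))
    obtain ⟨b, hb0, hb⟩ := mem_nhdsGE_iff_exists_Icc_subset.1 hev
    have hsub : Icc 0 (min b (1 / 2)) ⊆ Icc 0 b := Icc_subset_Icc_right (min_le_left _ _)
    refine ⟨min b (1 / 2), lt_min hb0 (by norm_num), (min_le_right _ _).trans_lt (by norm_num),
      fun r hr => (hb (hsub hr)).1.le, fun r hr => (hb (hsub hr)).2.le⟩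
  set c := |φ 0| / 2 with hcdef
  set M := 2 * |φ 0| with hMdef
  have hc0 : 0 < c := half_pos hφ0
  have hM0 : 0 < M := by positivity
  set K := omegaN 2 * (Real.pi ^ 2 / c ^ 2) with hK
  have hK0 : 0 ≤ K := mul_nonneg (omegaN_nonneg 2) (by positivity)
  set L := (K / δ + 1) * M ^ 2 with hL
  have hL0 : 0 < L := by positivity
  set α := β * Real.exp (-L) with hαdef
  have hα : 0 < α := by positivity
  have hαβ : α < β := mul_lt_of_lt_one_right hβ0 (Real.exp_lt_one_iff.2 (by linarith))
  have hsub : Icc α β ⊆ Icc 0 β := Icc_subset_Icc_left hα.le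
  have hc : ContinuousOn φ (Icc α β) := hcont.mono (hsub.trans (Icc_subset_Icc_right hβ1.le))
  have hne : ∀ r ∈ Icc α β, φ r ≠ 0 := fun r hr =>
    abs_pos.1 (hc0.trans_le (hlow r (hsub hr)))
  have hmass : K / δ + 1 ≤ annulusMass φ α β := by
    refine le_trans (le_of_eq ?_)
      (log_div_le_annulusMass hα hαβ hc hne fun r hr => hup r (hsub hr))
    have : β / α = Real.exp L := by
      rw [hαdef, Real.exp_neg]
      field_simp
    rw [this, Real.log_exp, hL]
    field_simp
  have hmeas := measurable_annulusPotential hα hαβ hc hne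
  obtain ⟨C, hC⟩ := exists_annulusPotential_le hα hαβ hc hne
  have habs : ∀ r, |μ + annulusPotential φ α β r| ≤ |μ| + C := fun r => by
    refine (abs_add_le _ _).trans ?_
    rw [abs_of_nonneg (annulusPotential_nonneg r)]
    exact add_le_add_right (hC r) _
  refine ⟨fun r => μ + annulusPotential φ α β r, ⟨hmeas.const_add μ, ⟨?_, ?_⟩,
    exists_solution_add_annulusPotential hφ hα hαβ hβ1 hne, ?_⟩, ?_, ?_⟩
  · exact ae_of_all _ fun r => le_add_of_nonneg_right (annulusPotential_nonneg r)
  · have hT := annulusMass_pos hα hαβ hc hne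
    refine lt_of_lt_of_le ?_ (measure_mono (s := Ioo α β) fun r hr => ?_)
    · simpa using hαβ
    · refine ⟨⟨hα.trans hr.1, hr.2.trans hβ1⟩, lt_add_of_pos_right μ ?_⟩
      rw [annulusPotential, indicator_of_mem hr]
      exact pow_pos (mul_pos (div_pos Real.pi_pos hT) (annulusWeight_pos hα hαβ hne r)) 2
  · rw [if_neg (by norm_num)]
    exact Or.inr ⟨|μ| + C, ae_of_all _ habs⟩
  · refine Measure.integrableOn_of_bounded (M := |μ| + C) (by simp) ?_ ?_
    · have := hmeas.const_add μ
      exact Measurable.aestronglyMeasurable (by fun_prop)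
    · filter_upwards [ae_restrict_mem measurableSet_Ioo] with r hr
      simp only [Nat.add_one_sub_one, pow_one, Real.rpow_one, norm_mul, Real.norm_eq_abs, abs_abs]
      rw [abs_of_pos hr.1]
      exact (mul_le_of_le_one_left (abs_nonneg _) hr.2.le).trans (habs r)
  · have hint := integral_annulusPotential_le hα hαβ hβ1 hc hc0 fun r hr => hlow r (hsub hr)
    have hT : 0 < annulusMass φ α β := annulusMass_pos hα hαβ hc hne
    rw [radialLpNorm_two_one]
    simp only [add_sub_cancel_left, abs_of_nonneg (annulusPotential_nonneg _)]
    refine (mul_le_mul_of_nonneg_left hint (omegaN_nonneg 2)).trans_lt ?_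
    rw [← mul_div_assoc, ← hK, div_lt_iff₀ hT]
    calc K < δ * (K / δ + 1) := by
          rw [mul_add, mul_div_cancel₀ _ hδ.ne']
          linarith
      _ ≤ δ * annulusMass φ α β := by gcongr

/-- The subcritical case for `N = 2`: `γ_{1,k} = 0`, i.e. for every `δ > 0`
there is `a ∈ Γ_k` (in particular `a ∈ L^q(B_1)` for some `q ∈ (1,∞]`) with
`‖a - μ_k‖_{L^1(B_1)} < δ`. -/
theorem stmt11 (k : ℕ) (μk : ℝ) (φk : ℝ → ℝ) (rz : ℕ → ℝ)
    (hek : IsRadialNeumannEigenpair 2 k μk φk rz) :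
    gammaLyap 2 μk 1 = 0 ∧
    ∀ δ : ℝ, 0 < δ → ∃ a : ℝ → ℝ, GammaSet 2 μk a ∧ RadialMemLp 2 1 a ∧
      radialLpNorm 2 1 (fun r => a r - μk) < δ := by
  have hsmall : ∀ δ : ℝ, 0 < δ → ∃ a : ℝ → ℝ, GammaSet 2 μk a ∧ RadialMemLp 2 1 a ∧
      radialLpNorm 2 1 (fun r => a r - μk) < δ := fun δ hδ =>
    exists_gammaSet_radialLpNorm_lt hek.2.1 hek.apply_zero_ne_zero hδ
  refine ⟨le_antisymm (le_of_forall_pos_lt_add fun δ hδ => ?_) (Real.sInf_nonneg ?_), hsmall⟩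
  · obtain ⟨a, ha, ha1, hlt⟩ := hsmall δ hδ
    rw [zero_add]
    refine lt_of_le_of_lt (csInf_le ⟨0, ?_⟩ ⟨a, ha, ha1, rfl⟩) hlt
    rintro _ ⟨b, -, -, rfl⟩
    exact radialLpNorm_nonneg _ _ _
  · rintro _ ⟨b, -, -, rfl⟩
    exact radialLpNorm_nonneg _ _ _
end
end

section
/- Let N = 2. For every δ > 0 there exist a radial function A ∈ L^∞(B_1) with ess inf_{(0,1)} A > 0 and 2π ∫_0^1 r A(r) dr < δ, and a nontrivial continuous function v : [0,1] → ℝ, differentiable on (0,1], such that v(1) = 0 and r v′(r) = −∫_0^r s A(s) v(s) ds for every r ∈ (0,1]. (That is, the radial Dirichlet problem Δv + A v = 0 in B_1, v = 0 on ∂B_1, admits a nontrivial radial solution for a strictly positive bounded potential A of arbitrarily small L^1(B_1) norm.) -/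
open MeasureTheory Set Filter

noncomputable section

/-- A logarithmic profile on the disc, vanishing together with its Laplacian at `r = 1`. -/
def logProfile (ε r : ℝ) : ℝ :=
  Real.log (1 + ε) - Real.log (r ^ 2 + ε) - ε / (1 + ε) ^ 2 * (1 - r ^ 2)

/-- The negative of the Laplacian of `logProfile ε` on the disc. -/
def logSource (ε r : ℝ) : ℝ :=
  4 * ε * (1 / (r ^ 2 + ε) ^ 2 - 1 / (1 + ε) ^ 2)

/-- The potential for which `logProfile ε` solves `Δv + A v = 0`. -/
def logPotential (ε r : ℝ) : ℝ := logSource ε r / logProfile ε r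

/-- The radial derivative of `logProfile ε`. -/
def logProfileDeriv (ε r : ℝ) : ℝ :=
  -(2 * r / (r ^ 2 + ε)) + 2 * ε / (1 + ε) ^ 2 * r

lemma hasDerivAt_logProfile {ε : ℝ} (hε : 0 < ε) (r : ℝ) :
    HasDerivAt (logProfile ε) (logProfileDeriv ε r) r := by
  have hr : r ^ 2 + ε ≠ 0 := by positivity
  have h1 : HasDerivAt (fun x : ℝ => x ^ 2) (2 * r) r := by
    simpa using hasDerivAt_pow 2 r
  have h := (((h1.add_const ε).log hr).const_sub (Real.log (1 + ε))).sub
    ((h1.const_sub 1).const_mul (ε / (1 + ε) ^ 2))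
  refine h.congr_deriv ?_
  unfold logProfileDeriv
  ring

lemma logSource_eq {ε : ℝ} (hε : 0 < ε) (r : ℝ) :
    logSource ε r =
      4 * ε * (1 - r ^ 2) * (1 + r ^ 2 + 2 * ε) / ((r ^ 2 + ε) ^ 2 * (1 + ε) ^ 2) := by
  have hr : r ^ 2 + ε ≠ 0 := by positivity
  have h1 : 1 + ε ≠ 0 := by positivity
  unfold logSource
  field_simp
  ring

lemma continuous_logSource {ε : ℝ} (hε : 0 < ε) : Continuous (logSource ε) := by
  have h : ∀ r : ℝ, (r ^ 2 + ε) ^ 2 ≠ 0 := fun r => by positivity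
  unfold logSource
  fun_prop (disch := exact h _)

lemma integral_mul_logSource {ε : ℝ} (hε : 0 < ε) (r : ℝ) :
    ∫ s in (0:ℝ)..r, s * logSource ε s = -(r * logProfileDeriv ε r) := by
  have hd : ∀ x ∈ uIcc 0 r,
      HasDerivAt (fun x => -(x * logProfileDeriv ε x)) (x * logSource ε x) x := by
    intro x _
    have hx : x ^ 2 + ε ≠ 0 := by positivity
    have h1 : HasDerivAt (fun x : ℝ => x ^ 2) (2 * x) x := by
      simpa using hasDerivAt_pow 2 x
    have h2 := (((hasDerivAt_id x).const_mul 2).div (h1.add_const ε) hx).neg.add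
      ((hasDerivAt_id x).const_mul (2 * ε / (1 + ε) ^ 2))
    refine ((hasDerivAt_id x).mul h2).neg.congr_deriv ?_
    have h3 : 1 + ε ≠ 0 := by positivity
    simp only [logSource, id, Pi.add_apply, Pi.neg_apply, Pi.div_apply]
    field_simp
    ring
  rw [intervalIntegral.integral_eq_sub_of_hasDerivAt hd
    ((continuous_id.mul (continuous_logSource hε)).intervalIntegrable _ _)]
  simp

lemma le_logProfile {ε : ℝ} (hε : 0 < ε) (r : ℝ) :
    (1 - r ^ 2) / (1 + ε) ^ 2 ≤ logProfile ε r := by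
  have h := Real.log_le_sub_one_of_pos (show 0 < (r ^ 2 + ε) / (1 + ε) by positivity)
  rw [Real.log_div (by positivity) (by positivity)] at h
  have h3 : (r ^ 2 + ε) / (1 + ε) - 1 =
      -((1 - r ^ 2) / (1 + ε) ^ 2 + ε / (1 + ε) ^ 2 * (1 - r ^ 2)) := by
    field_simp
    ring
  unfold logProfile
  linarith

lemma logProfile_le {ε r : ℝ} (hε : 0 < ε) (hr : r ^ 2 ≤ 1) :
    logProfile ε r ≤ (1 - r ^ 2) / (r ^ 2 + ε) := by
  have h := Real.log_le_sub_one_of_pos (show 0 < (1 + ε) / (r ^ 2 + ε) by positivity)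
  rw [Real.log_div (by positivity) (by positivity)] at h
  have h3 : (1 + ε) / (r ^ 2 + ε) - 1 = (1 - r ^ 2) / (r ^ 2 + ε) := by
    field_simp
    ring
  have h4 : 0 ≤ ε / (1 + ε) ^ 2 * (1 - r ^ 2) :=
    mul_nonneg (by positivity) (by linarith)
  unfold logProfile
  linarith

lemma logProfile_pos {ε r : ℝ} (hε : 0 < ε) (hr : r ^ 2 < 1) : 0 < logProfile ε r :=
  lt_of_lt_of_le (div_pos (by linarith) (by positivity)) (le_logProfile hε r)

lemma logProfile_one (ε : ℝ) : logProfile ε 1 = 0 := by simp [logProfile]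

lemma logPotential_mul_logProfile {ε r : ℝ} (hε : 0 < ε) (hr : r ∈ Icc (0:ℝ) 1) :
    logPotential ε r * logProfile ε r = logSource ε r := by
  rcases hr.2.eq_or_lt with rfl | h
  · simp [logProfile_one, logSource]
  · exact div_mul_cancel₀ _ (logProfile_pos hε (by nlinarith [hr.1])).ne'

lemma logPotential_le {ε r : ℝ} (hε : 0 < ε) (hr : r ^ 2 < 1) :
    logPotential ε r ≤ 4 * ε * (1 + r ^ 2 + 2 * ε) / (r ^ 2 + ε) ^ 2 := by
  have hs : 0 < 1 - r ^ 2 := by linarith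
  rw [logPotential, div_le_iff₀ (logProfile_pos hε hr), logSource_eq hε]
  calc _ = 4 * ε * (1 + r ^ 2 + 2 * ε) / (r ^ 2 + ε) ^ 2 * ((1 - r ^ 2) / (1 + ε) ^ 2) := by
        field_simp
    _ ≤ _ := mul_le_mul_of_nonneg_left (le_logProfile hε r) (by positivity)

lemma le_logPotential {ε r : ℝ} (hε : 0 < ε) (hr : r ^ 2 < 1) :
    4 * ε / (1 + ε) ^ 2 ≤ logPotential ε r := by
  have hs : 0 < 1 - r ^ 2 := by linarith
  rw [logPotential, le_div_iff₀ (logProfile_pos hε hr), logSource_eq hε]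
  calc _ ≤ 4 * ε / (1 + ε) ^ 2 * ((1 - r ^ 2) / (r ^ 2 + ε)) :=
        mul_le_mul_of_nonneg_left (logProfile_le hε hr.le) (by positivity)
    _ = 4 * ε * (1 - r ^ 2) * (r ^ 2 + ε) / ((r ^ 2 + ε) ^ 2 * (1 + ε) ^ 2) := by
        field_simp
    _ ≤ _ := by
        gcongr <;> linarith

lemma measurable_logPotential (ε : ℝ) : Measurable (logPotential ε) := by
  unfold logPotential logSource logProfile
  fun_prop

/-- Near the origin the profile is large, away from it the source is small. -/
lemma logPotential_le_add {η L r : ℝ} (hη : 0 < η) (hη' : η ≤ 1 / 2) (hL : 0 < L)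
    (hLη : L + 1 ≤ -Real.log (2 * η)) (hr : r ^ 2 < 1) :
    logPotential (η ^ 3) r ≤ 4 * η ^ 3 / (r ^ 2 + η ^ 3) ^ 2 / L + 16 * η := by
  have hε : 0 < η ^ 3 := by positivity
  have hεη : η ^ 3 ≤ η := by nlinarith [mul_pos hη hη]
  rcases le_total (r ^ 2) η with h | h
  · have hlog : Real.log (r ^ 2 + η ^ 3) ≤ Real.log (2 * η) :=
      Real.log_le_log (by positivity) (by linarith)
    have hlog1 : 0 ≤ Real.log (1 + η ^ 3) := Real.log_nonneg (by linarith)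
    have hk : η ^ 3 / (1 + η ^ 3) ^ 2 * (1 - r ^ 2) ≤ 1 :=
      mul_le_one₀ ((div_le_one (by positivity)).2 (by nlinarith)) (by linarith)
        (by nlinarith [sq_nonneg r])
    have hP : L ≤ logProfile (η ^ 3) r := by
      unfold logProfile
      linarith
    have hS : logSource (η ^ 3) r ≤ 4 * η ^ 3 / (r ^ 2 + η ^ 3) ^ 2 := by
      have : 0 ≤ 4 * η ^ 3 * (1 / (1 + η ^ 3) ^ 2) := by positivity
      rw [logSource, mul_sub, mul_one_div (4 * η ^ 3) ((r ^ 2 + η ^ 3) ^ 2)]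
      linarith
    have : logPotential (η ^ 3) r ≤ 4 * η ^ 3 / (r ^ 2 + η ^ 3) ^ 2 / L :=
      div_le_div₀ (by positivity) hS hL hP
    linarith
  · have h1 : 4 * η ^ 3 * (1 + r ^ 2 + 2 * η ^ 3) / (r ^ 2 + η ^ 3) ^ 2 ≤
        4 * η ^ 3 * 4 / η ^ 2 := by
      gcongr <;> linarith
    have h2 : 4 * η ^ 3 * 4 / η ^ 2 = 16 * η := by
      field_simp
      ring
    have h3 : 0 ≤ 4 * η ^ 3 / (r ^ 2 + η ^ 3) ^ 2 / L := by positivity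
    linarith [logPotential_le hε hr]

lemma integral_mul_logPotential_le {η L : ℝ} (hη : 0 < η) (hη' : η ≤ 1 / 2) (hL : 0 < L)
    (hLη : L + 1 ≤ -Real.log (2 * η)) :
    ∫ r in (0:ℝ)..1, r * logPotential (η ^ 3) r ≤ 2 / L + 8 * η := by
  have hε : 0 < η ^ 3 := by positivity
  set ε := η ^ 3
  have hd : ∀ x ∈ uIcc (0:ℝ) 1,
      HasDerivAt (fun x => -(2 * ε / (x ^ 2 + ε)) / L + 8 * η * x ^ 2)
        (x * (4 * ε / (x ^ 2 + ε) ^ 2 / L + 16 * η)) x := by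
    intro x _
    have hx : x ^ 2 + ε ≠ 0 := by positivity
    have h1 : HasDerivAt (fun x : ℝ => x ^ 2) (2 * x) x := by
      simpa using hasDerivAt_pow 2 x
    refine ((((hasDerivAt_const x (2 * ε)).div (h1.add_const ε) hx).neg.div_const L).add
      (h1.const_mul (8 * η))).congr_deriv ?_
    field_simp
    ring
  have hc : Continuous fun x : ℝ => x * (4 * ε / (x ^ 2 + ε) ^ 2 / L + 16 * η) := by
    have h : ∀ r : ℝ, (r ^ 2 + ε) ^ 2 ≠ 0 := fun r => by positivity
    have hL' := hL.ne'
    fun_prop (disch := first | exact h _ | assumption)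
  have hgi := hc.intervalIntegrable (μ := volume) 0 1
  calc ∫ r in (0:ℝ)..1, r * logPotential ε r
      ≤ ∫ r in (0:ℝ)..1, r * (4 * ε / (r ^ 2 + ε) ^ 2 / L + 16 * η) := by
        rw [intervalIntegral.integral_of_le zero_le_one,
          intervalIntegral.integral_of_le zero_le_one,
          integral_Ioc_eq_integral_Ioo, integral_Ioc_eq_integral_Ioo]
        refine integral_mono_of_nonneg ?_
          ((intervalIntegrable_iff_integrableOn_Ioo_of_le zero_le_one).1 hgi) ?_
        · filter_upwards [ae_restrict_mem measurableSet_Ioo] with r hr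
          have hr2 : r ^ 2 < 1 := by nlinarith [hr.1, hr.2]
          exact mul_nonneg hr.1.le (le_trans (by positivity) (le_logPotential hε hr2))
        · filter_upwards [ae_restrict_mem measurableSet_Ioo] with r hr
          have hr2 : r ^ 2 < 1 := by nlinarith [hr.1, hr.2]
          exact mul_le_mul_of_nonneg_left (logPotential_le_add hη hη' hL hLη hr2) hr.1.le
    _ = 2 / L + 8 * η - 2 * ε / (1 + ε) / L := by
        rw [intervalIntegral.integral_eq_sub_of_hasDerivAt hd hgi]
        field_simp
        ring
    _ ≤ 2 / L + 8 * η := sub_le_self _ (by positivity)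

/-- For `N = 2` and every `δ > 0` there are a radial `A ∈ L^∞(B_1)` with
`ess inf A > 0` and `2π ∫_0^1 r A(r) dr < δ`, and a nontrivial radial solution `v` of the
Dirichlet problem `Δv + A v = 0` in `B_1`, `v = 0` on `∂B_1` (integrated radial form). -/
theorem stmt12 (δ : ℝ) (hδ : 0 < δ) :
    ∃ A v v' : ℝ → ℝ,
      Measurable A ∧
      (∃ c : ℝ, 0 < c ∧ ∀ᵐ r ∂(volume.restrict (Ioo (0:ℝ) 1)), c ≤ A r) ∧
      (∃ C : ℝ, ∀ᵐ r ∂(volume.restrict (Ioo (0:ℝ) 1)), |A r| ≤ C) ∧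
      2 * Real.pi * (∫ r in (0:ℝ)..1, r * A r) < δ ∧
      ContinuousOn v (Icc (0:ℝ) 1) ∧
      (∀ r ∈ Ioc (0:ℝ) 1, HasDerivAt v (v' r) r) ∧
      v 1 = 0 ∧ (∃ r ∈ Icc (0:ℝ) 1, v r ≠ 0) ∧
      (∀ r ∈ Ioc (0:ℝ) 1, r * v' r = - ∫ s in (0:ℝ)..r, s * A s * v s) := by
  obtain ⟨L, hL, hLδ⟩ : ∃ L : ℝ, 0 < L ∧ 12 * Real.pi / L < δ := by
    refine ⟨13 * Real.pi / δ, by positivity, ?_⟩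
    rw [div_lt_iff₀ (by positivity), mul_div_cancel₀ _ hδ.ne']
    linarith [Real.pi_pos]
  obtain ⟨η, hη, hη', hLη, hηL⟩ : ∃ η : ℝ, 0 < η ∧ η ≤ 1 / 2 ∧
      L + 1 ≤ -Real.log (2 * η) ∧ η ≤ 1 / (2 * L) := by
    have hexp : Real.exp (-(L + 1)) ≤ 1 / L := by
      rw [Real.exp_neg, ← one_div]
      exact one_div_le_one_div_of_le hL (by linarith [Real.add_one_le_exp (L + 1)])
    refine ⟨Real.exp (-(L + 1)) / 2, by positivity, ?_, ?_, ?_⟩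
    · have : Real.exp (-(L + 1)) ≤ 1 := Real.exp_le_one_iff.2 (by linarith)
      linarith
    · rw [mul_div_cancel₀ _ two_ne_zero, Real.log_exp]
      linarith
    · rw [one_div, mul_inv, ← one_div L]
      linarith
  have hε : 0 < η ^ 3 := by positivity
  refine ⟨logPotential (η ^ 3), logProfile (η ^ 3), logProfileDeriv (η ^ 3),
    measurable_logPotential _, ⟨4 * η ^ 3 / (1 + η ^ 3) ^ 2, by positivity, ?_⟩,
    ⟨4 * η ^ 3 * (2 + 2 * η ^ 3) / (η ^ 3) ^ 2, ?_⟩, ?_,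
    fun r _ => (hasDerivAt_logProfile hε r).continuousAt.continuousWithinAt,
    fun r _ => hasDerivAt_logProfile hε r, logProfile_one _,
    ⟨0, by simp, (logProfile_pos hε (by simp)).ne'⟩, ?_⟩
  · filter_upwards [ae_restrict_mem measurableSet_Ioo] with r hr
    exact le_logPotential hε (by nlinarith [hr.1, hr.2])
  · filter_upwards [ae_restrict_mem measurableSet_Ioo] with r hr
    have hr2 : r ^ 2 < 1 := by nlinarith [hr.1, hr.2]
    rw [abs_of_nonneg (le_trans (by positivity) (le_logPotential hε hr2))]
    refine (logPotential_le hε hr2).trans ?_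
    gcongr
    · linarith
    · linarith [sq_nonneg r]
  · have h := integral_mul_logPotential_le hη hη' hL hLη
    calc _ ≤ 2 * Real.pi * (2 / L + 8 * (1 / (2 * L))) := by
          gcongr
          linarith
      _ = 12 * Real.pi / L := by
          field_simp
          ring
      _ < δ := hLδ
  · intro r hr
    rw [← neg_eq_iff_eq_neg, ← integral_mul_logSource hε r]
    refine intervalIntegral.integral_congr fun s hs => ?_
    rw [uIcc_of_le hr.1.le] at hs
    simp only [mul_assoc, logPotential_mul_logProfile hε ⟨hs.1, hs.2.trans hr.2⟩]
end
end

section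
/- Let k ≥ 0 and N ≥ 2, and let (μ_{k+1}, φ_{k+1}) be the (k+1)-th radial Neumann eigenpair, with μ_k < μ_{k+1}. Then γ_{∞,k} = μ_{k+1} − μ_k, this infimum is attained at the constant function a_0 ≡ μ_{k+1} ∈ Γ_k, and a_0 is the unique minimizer: if a ∈ Γ_k ∩ L^∞(B_1) satisfies ‖a − μ_k‖_{L^∞(B_1)} = μ_{k+1} − μ_k, then a = μ_{k+1} a.e. on (0,1). -/
open MeasureTheory Set Filter

noncomputable section

/-- The flux `-∫_0^r s^(N-1) a(s) u(s) ds`, which equals `r^(N-1) u'(r)` for a solution `u`. -/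
def flux (N : ℕ) (a u : ℝ → ℝ) (r : ℝ) : ℝ := -∫ s in (0:ℝ)..r, s ^ (N - 1) * a s * u s

/-- A radial Neumann solution whose potential is measurable, nonnegative and bounded. -/
structure BoundedSolution (N : ℕ) (a u : ℝ → ℝ) : Prop where
  meas : Measurable a
  nonneg : ∀ r, 0 ≤ a r
  bdd : ∃ C, ∀ r, a r ≤ C
  cont : ContinuousOn u (Icc 0 1)
  deriv : ∀ r ∈ Ioc (0:ℝ) 1, HasDerivAt u (flux N a u r / r ^ (N - 1)) r
  flux_one : flux N a u 1 = 0

lemma flux_zero (N : ℕ) (a u : ℝ → ℝ) : flux N a u 0 = 0 := by simp [flux]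

lemma flux_neg (N : ℕ) (a u : ℝ → ℝ) (r : ℝ) :
    flux N a (fun x => -u x) r = -flux N a u r := by
  simp [flux]

/-- A continuous function dominated by a multiple of its primitive vanishes. -/
lemma eq_zero_of_le_integral {h : ℝ → ℝ} {x y C : ℝ} (hc : ContinuousOn h (Icc x y))
    (h0 : ∀ r ∈ Icc x y, 0 ≤ h r) (hle : ∀ r ∈ Icc x y, h r ≤ C * ∫ s in x..r, h s) :
    ∀ r ∈ Icc x y, h r = 0 := by
  intro r hr
  have hxy : x ≤ y := hr.1.trans hr.2
  let g : ℝ → ℝ := IccExtend hxy ((Icc x y).domRestrict h)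
  have hg : Continuous g := (continuousOn_iff_continuous_domRestrict.1 hc).Icc_extend'
  have hgh : ∀ s ∈ Icc x y, g s = h s := fun s hs => IccExtend_of_mem hxy _ hs
  have hint : ∀ s ∈ Icc x y, ∫ t in x..s, h t = ∫ t in x..s, g t := by
    intro s hs
    refine intervalIntegral.integral_congr fun t ht => ?_
    rw [uIcc_of_le hs.1] at ht
    exact (hgh t ⟨ht.1, ht.2.trans hs.2⟩).symm
  have hpos : ∀ s ∈ Icc x y, 0 ≤ ∫ t in x..s, g t := by
    intro s hs
    refine intervalIntegral.integral_nonneg hs.1 fun t ht => ?_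
    have ht' : t ∈ Icc x y := ⟨ht.1, ht.2.trans hs.2⟩
    rw [hgh t ht']
    exact h0 t ht'
  have hd : ∀ s, HasDerivAt (fun s => ∫ t in x..s, g t) (g s) s := fun s =>
    intervalIntegral.integral_hasDerivAt_right (hg.intervalIntegrable _ _)
      (hg.stronglyMeasurableAtFilter _ _) hg.continuousAt
  have key := norm_le_gronwallBound_of_norm_deriv_right_le (f := fun s => ∫ t in x..s, g t)
    (f' := g) (δ := 0) (K := C) (ε := 0) (a := x) (b := y)
    (fun s _ => (hd s).continuousAt.continuousWithinAt)
    (fun s _ => (hd s).hasDerivWithinAt) (by simp)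
    (by
      intro s hs
      have hs' := Ico_subset_Icc_self hs
      rw [hgh s hs', Real.norm_of_nonneg (h0 s hs'), Real.norm_of_nonneg (hpos s hs'), add_zero,
        ← hint s hs']
      exact hle s hs') r hr
  rw [gronwallBound_ε0_δ0, Real.norm_of_nonneg (hpos r hr), ← hint r hr] at key
  have h1 : 0 ≤ ∫ t in x..r, h t := by rw [hint r hr]; exact hpos r hr
  have h2 := hle r hr
  rw [le_antisymm key h1, mul_zero] at h2
  exact le_antisymm h2 (h0 r hr)

/-- The version of `eq_zero_of_le_integral` with the primitive based at the right endpoint. -/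
lemma eq_zero_of_le_integral_left {h : ℝ → ℝ} {x y C : ℝ} (hc : ContinuousOn h (Icc x y))
    (h0 : ∀ r ∈ Icc x y, 0 ≤ h r) (hle : ∀ r ∈ Icc x y, h r ≤ C * ∫ s in r..y, h s) :
    ∀ r ∈ Icc x y, h r = 0 := by
  have hm : ∀ s ∈ Icc x y, x + y - s ∈ Icc x y := fun s hs => by
    constructor <;> linarith [hs.1, hs.2]
  have key := eq_zero_of_le_integral (h := fun s => h (x + y - s)) (x := x) (y := y) (C := C)
    (hc.comp (by fun_prop) hm) (fun r hr => h0 _ (hm r hr)) (fun r hr => by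
      rw [intervalIntegral.integral_comp_sub_left (fun t => h t) (x + y)]
      simpa using hle _ (hm r hr))
  intro r hr
  simpa using key _ (hm r hr)

namespace BoundedSolution

variable {N : ℕ} {a b u v : ℝ → ℝ}

lemma neg (h : BoundedSolution N a u) : BoundedSolution N a (fun x => -u x) where
  meas := h.meas
  nonneg := h.nonneg
  bdd := h.bdd
  cont := h.cont.neg
  deriv r hr := by
    rw [flux_neg, neg_div]
    exact (h.deriv r hr).neg
  flux_one := by rw [flux_neg, h.flux_one, neg_zero]

/-- The integrand of the flux is integrable, also against a second continuous function. -/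
lemma integrableOn_aux {w : ℝ → ℝ} (h : BoundedSolution N a u) (hw : ContinuousOn w (Icc 0 1)) :
    IntegrableOn (fun s => s ^ (N - 1) * a s * w s) (Icc 0 1) := by
  obtain ⟨C, hC⟩ := h.bdd
  have h1 : IntegrableOn (fun s => s ^ (N - 1) * w s) (Icc (0:ℝ) 1) :=
    ContinuousOn.integrableOn_Icc (by fun_prop)
  have h2 := Integrable.bdd_mul (c := C) h1 h.meas.aestronglyMeasurable
    (Eventually.of_forall fun s => by rw [Real.norm_of_nonneg (h.nonneg s)]; exact hC s)
  refine h2.congr (Eventually.of_forall fun s => ?_)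
  simp only
  ring

lemma intervalIntegrable_aux {w : ℝ → ℝ} (h : BoundedSolution N a u)
    (hw : ContinuousOn w (Icc 0 1)) {x y : ℝ} (hx : x ∈ Icc (0:ℝ) 1) (hy : y ∈ Icc (0:ℝ) 1) :
    IntervalIntegrable (fun s => s ^ (N - 1) * a s * w s) volume x y :=
  ((h.integrableOn_aux hw).mono_set (uIcc_subset_Icc hx hy)).intervalIntegrable

lemma flux_sub (h : BoundedSolution N a u) {x y : ℝ} (hx : x ∈ Icc (0:ℝ) 1)
    (hy : y ∈ Icc (0:ℝ) 1) :
    flux N a u y - flux N a u x = -∫ s in x..y, s ^ (N - 1) * a s * u s := by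
  have h0 : (0:ℝ) ∈ Icc (0:ℝ) 1 := by simp
  rw [flux, flux, ← intervalIntegral.integral_add_adjacent_intervals
    (h.intervalIntegrable_aux h.cont h0 hx) (h.intervalIntegrable_aux h.cont hx hy)]
  ring

lemma flux_ac (h : BoundedSolution N a u) : AbsolutelyContinuousOnInterval (flux N a u) 0 1 :=
  ((h.intervalIntegrable_aux h.cont (by simp) (by simp)
    ).absolutelyContinuousOnInterval_intervalIntegral (by simp)).neg

lemma flux_cont (h : BoundedSolution N a u) : ContinuousOn (flux N a u) (Icc 0 1) := by
  simpa using h.flux_ac.continuousOn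

lemma ae_hasDerivAt_flux (h : BoundedSolution N a u) :
    ∀ᵐ r, r ∈ Icc (0:ℝ) 1 → HasDerivAt (flux N a u) (-(r ^ (N - 1) * a r * u r)) r := by
  filter_upwards [(h.intervalIntegrable_aux h.cont (x := 0) (y := 1) (by simp) (by simp)
    ).ae_hasDerivAt_integral] with r hr hr'
  rw [uIcc_of_le zero_le_one] at hr
  exact (hr hr' 0 (by simp)).neg

lemma exists_lipschitz (h : BoundedSolution N a u) : ∃ K, LipschitzOnWith K u (Icc 0 1) := by
  obtain ⟨C, hC⟩ := h.bdd
  obtain ⟨M, hM⟩ := isCompact_Icc.exists_bound_of_continuousOn h.cont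
  have hM0 : 0 ≤ M := (norm_nonneg _).trans (hM 0 (by simp))
  have hC0 : 0 ≤ C := (h.nonneg 0).trans (hC 0)
  have hb : ∀ r ∈ Ioc (0:ℝ) 1, ‖flux N a u r / r ^ (N - 1)‖ ≤ C * M := by
    intro r hr
    have hp : 0 < r ^ (N - 1) := pow_pos hr.1 _
    rw [norm_div, Real.norm_of_nonneg hp.le, div_le_iff₀ hp, flux, norm_neg]
    refine (intervalIntegral.norm_integral_le_of_norm_le_const
      (C := r ^ (N - 1) * C * M) fun s hs => ?_).trans ?_
    · rw [uIoc_of_le hr.1.le] at hs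
      rw [norm_mul, norm_mul, norm_pow, Real.norm_of_nonneg hs.1.le,
        Real.norm_of_nonneg (h.nonneg s)]
      have := hM s ⟨hs.1.le, hs.2.trans hr.2⟩
      have h1 := hs.1.le
      have h2 := hs.2
      have h3 := h.nonneg s
      have h4 := hC s
      gcongr
    · rw [sub_zero, abs_of_pos hr.1]
      have : 0 ≤ C * M * r ^ (N - 1) := by positivity
      nlinarith [hr.2]
  have hl : LipschitzOnWith ⟨C * M, by positivity⟩ u (Ioc 0 1) :=
    (convex_Ioc 0 1).lipschitzOnWith_of_nnnorm_hasDerivWithin_le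
      (fun r hr => (h.deriv r hr).hasDerivWithinAt) fun r hr => hb r hr
  have hcl : closure (Ioc (0:ℝ) 1) = Icc 0 1 := closure_Ioc zero_ne_one
  exact ⟨_, hcl ▸ hl.closure (by rw [hcl]; exact h.cont)⟩

lemma ac (h : BoundedSolution N a u) : AbsolutelyContinuousOnInterval u 0 1 := by
  obtain ⟨K, hK⟩ := h.exists_lipschitz
  rw [← uIcc_of_le zero_le_one] at hK
  exact hK.absolutelyContinuousOnInterval

/-- Lagrange's identity for the Wronskian of two solutions. -/
lemma wronskian_sub (hu : BoundedSolution N a u) (hv : BoundedSolution N b v) {x y : ℝ}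
    (hx : x ∈ Icc (0:ℝ) 1) (hy : y ∈ Icc (0:ℝ) 1) :
    (flux N a u y * v y - u y * flux N b v y) - (flux N a u x * v x - u x * flux N b v x) =
      ∫ s in x..y, s ^ (N - 1) * (b s - a s) * (u s * v s) := by
  have hsub : uIcc x y ⊆ uIcc 0 1 := by
    rw [uIcc_of_le (zero_le_one' ℝ)]; exact uIcc_subset_Icc hx hy
  have hac := ((hu.flux_ac.fun_mul hv.ac).sub (hu.ac.fun_mul hv.flux_ac)).mono hsub
  have key := hac.integral_deriv_eq_sub
  simp only [Pi.sub_apply] at key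
  rw [← key]
  refine intervalIntegral.integral_congr_ae ?_
  filter_upwards [hu.ae_hasDerivAt_flux, hv.ae_hasDerivAt_flux,
    (measure_eq_zero_iff_ae_notMem.1 (measure_singleton (μ := volume) (0:ℝ)))] with r h1 h2 h0 hr
  have hr' : r ∈ Icc (0:ℝ) 1 := uIcc_subset_Icc hx hy (uIoc_subset_uIcc hr)
  have hr0 : 0 < r := lt_of_le_of_ne hr'.1 fun e => h0 (by simp [← e])
  have hr1 : r ∈ Ioc (0:ℝ) 1 := ⟨hr0, hr'.2⟩
  have hd := ((h1 hr').mul (hv.deriv r hr1)).sub ((hu.deriv r hr1).mul (h2 hr'))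
  refine (hd.deriv).trans ?_
  have hp : r ^ (N - 1) ≠ 0 := (pow_pos hr0 _).ne'
  field_simp
  ring

lemma flux_antitone (h : BoundedSolution N a u) {x y : ℝ} (hx : 0 ≤ x) (hxy : x ≤ y) (hy : y ≤ 1)
    (hu : ∀ s ∈ Ioo x y, 0 ≤ u s) : flux N a u y ≤ flux N a u x := by
  rw [← sub_nonpos, h.flux_sub ⟨hx, hxy.trans hy⟩ ⟨hx.trans hxy, hy⟩, neg_nonpos,
    intervalIntegral.integral_of_le hxy, integral_Ioc_eq_integral_Ioo]
  refine setIntegral_nonneg measurableSet_Ioo fun s hs => ?_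
  have := h.nonneg s
  have := hu s hs
  have := hx.trans hs.1.le
  positivity

/-- At a left zero of a positive arch away from the origin, the flux is positive. -/
lemma flux_pos_left (h : BoundedSolution N a u) {x y : ℝ} (hx : 0 < x) (hxy : x < y) (hy : y ≤ 1)
    (hu : ∀ s ∈ Ioo x y, 0 < u s) (hux : u x = 0) : 0 < flux N a u x := by
  by_contra! hneg
  have hanti : AntitoneOn u (Icc x ((x + y) / 2)) := by
    refine antitoneOn_of_deriv_nonpos (convex_Icc _ _)
      (h.cont.mono (Icc_subset_Icc hx.le (by linarith))) ?_ ?_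
    · intro s hs
      rw [interior_Icc] at hs
      exact (h.deriv s ⟨hx.trans hs.1, by linarith [hs.2]⟩).differentiableAt.differentiableWithinAt
    · intro s hs
      rw [interior_Icc] at hs
      have hs0 := hx.trans hs.1
      rw [(h.deriv s ⟨hs0, by linarith [hs.2]⟩).deriv]
      refine div_nonpos_of_nonpos_of_nonneg (le_trans ?_ hneg) (by positivity)
      exact h.flux_antitone hx.le hs.1.le (by linarith [hs.2])
        fun t ht => (hu t ⟨ht.1, by linarith [ht.2, hs.2]⟩).le
  have h1 := hanti ⟨le_rfl, by linarith⟩ ⟨by linarith, le_rfl⟩ (by linarith : x ≤ (x + y) / 2)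
  linarith [hu ((x + y) / 2) ⟨by linarith, by linarith⟩]

/-- At a right zero of a positive arch, the flux is negative. -/
lemma flux_neg_right (h : BoundedSolution N a u) {x y : ℝ} (hx : 0 ≤ x) (hxy : x < y) (hy : y ≤ 1)
    (hu : ∀ s ∈ Ioo x y, 0 < u s) (huy : u y = 0) : flux N a u y < 0 := by
  by_contra! hpos
  have hmono : MonotoneOn u (Icc ((x + y) / 2) y) := by
    refine monotoneOn_of_deriv_nonneg (convex_Icc _ _)
      (h.cont.mono (Icc_subset_Icc (by linarith) hy)) ?_ ?_
    · intro s hs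
      rw [interior_Icc] at hs
      exact (h.deriv s ⟨by linarith [hs.1], by linarith [hs.2]⟩
        ).differentiableAt.differentiableWithinAt
    · intro s hs
      rw [interior_Icc] at hs
      have hs0 : 0 < s := by linarith [hs.1]
      rw [(h.deriv s ⟨hs0, by linarith [hs.2]⟩).deriv]
      refine div_nonneg (hpos.trans ?_) (by positivity)
      exact h.flux_antitone hs0.le hs.2.le hy
        fun t ht => (hu t ⟨by linarith [ht.1, hs.1], ht.2⟩).le
  have h1 := hmono ⟨le_rfl, by linarith⟩ ⟨by linarith, le_rfl⟩ (by linarith : (x + y) / 2 ≤ y)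
  linarith [hu ((x + y) / 2) ⟨by linarith, by linarith⟩]

/-- Sturm comparison on an arch of `u` where both solutions are positive. -/
lemma sturm_of_pos (hu : BoundedSolution N a u) (hv : BoundedSolution N b v)
    (hab : ∀ r, a r ≤ b r) {x y : ℝ} (hx : 0 ≤ x) (hxy : x < y) (hy : y ≤ 1)
    (hup : ∀ s ∈ Ioo x y, 0 < u s) (hvp : ∀ s ∈ Ioo x y, 0 < v s)
    (hux : x = 0 ∨ u x = 0) (huy : y = 1 ∨ u y = 0) :
    (∀ᵐ r ∂volume.restrict (Ioc x y), a r = b r) ∧ (x = 0 ∨ v x = 0) ∧ (y = 1 ∨ v y = 0) := by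
  have hxm : x ∈ Icc (0:ℝ) 1 := ⟨hx, hxy.le.trans hy⟩
  have hym : y ∈ Icc (0:ℝ) 1 := ⟨hx.trans hxy.le, hy⟩
  have hcl : closure (Ioo x y) = Icc x y := closure_Ioo hxy.ne
  have hv0 : ∀ s ∈ Icc x y, 0 ≤ v s := by
    intro s hs
    rw [← hcl] at hs
    exact le_on_closure (f := fun _ => (0:ℝ)) (fun s hs => (hvp s hs).le) continuousOn_const
      (by rw [hcl]; exact hv.cont.mono (Icc_subset_Icc hx hy)) hs
  have hvx := hv0 x (left_mem_Icc.2 hxy.le)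
  have hvy := hv0 y (right_mem_Icc.2 hxy.le)
  have hWx : 0 ≤ flux N a u x * v x - u x * flux N b v x := by
    rcases hux with rfl | h0
    · simp [flux_zero]
    · rw [h0, zero_mul, sub_zero]
      rcases hx.eq_or_lt with rfl | hx'
      · simp [flux_zero]
      · exact mul_nonneg (hu.flux_pos_left hx' hxy hy hup h0).le hvx
  have hWy : flux N a u y * v y - u y * flux N b v y ≤ 0 := by
    rcases huy with rfl | h0
    · simp [hu.flux_one, hv.flux_one]
    · rw [h0, zero_mul, sub_zero]
      exact mul_nonpos_of_nonpos_of_nonneg (hu.flux_neg_right hx hxy hy hup h0).le hvy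
  have hW := hu.wronskian_sub hv hxm hym
  have hint : IntervalIntegrable (fun s => s ^ (N - 1) * (b s - a s) * (u s * v s)) volume x y := by
    refine ((hv.intervalIntegrable_aux (hu.cont.mul hv.cont) hxm hym).sub
      (hu.intervalIntegrable_aux (hu.cont.mul hv.cont) hxm hym)).congr
      fun s _ => ?_
    simp only [Pi.mul_apply]
    ring
  have hnn : 0 ≤ᵐ[volume.restrict (Ioc x y)]
      fun s => s ^ (N - 1) * (b s - a s) * (u s * v s) := by
    rw [← restrict_Ioo_eq_restrict_Ioc]
    refine (ae_restrict_iff' measurableSet_Ioo).2 (Eventually.of_forall fun s hs => ?_)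
    have h1 := hup s hs
    have h2 := hvp s hs
    have h3 := sub_nonneg.2 (hab s)
    have h4 : 0 ≤ s := hx.trans hs.1.le
    simp only [Pi.zero_apply]
    positivity
  have hI0 : 0 ≤ ∫ s in x..y, s ^ (N - 1) * (b s - a s) * (u s * v s) := by
    rw [intervalIntegral.integral_of_le hxy.le]
    exact integral_nonneg_of_ae hnn
  have hI : ∫ s in x..y, s ^ (N - 1) * (b s - a s) * (u s * v s) = 0 := by linarith
  refine ⟨?_, ?_, ?_⟩
  · rw [intervalIntegral.integral_eq_zero_iff_of_le_of_nonneg_ae hxy.le hnn hint] at hI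
    rw [← restrict_Ioo_eq_restrict_Ioc] at hI ⊢
    filter_upwards [hI, ae_restrict_mem measurableSet_Ioo] with s hs hsm
    have h1 := (hup s hsm).ne'
    have h2 := (hvp s hsm).ne'
    have h4 : s ^ (N - 1) ≠ 0 := (pow_pos (hx.trans_lt hsm.1) _).ne'
    simp only [Pi.zero_apply, mul_eq_zero, h1, h2, h4, or_false, false_or] at hs
    linarith
  · rcases hux with h | h0
    · exact Or.inl h
    · rcases hx.eq_or_lt with h | hx'
      · exact Or.inl h.symm
      · right
        have : flux N a u x * v x = 0 := by
          have : flux N a u x * v x - u x * flux N b v x = 0 := by linarith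
          rwa [h0, zero_mul, sub_zero] at this
        exact (mul_eq_zero.1 this).resolve_left (hu.flux_pos_left hx' hxy hy hup h0).ne'
  · rcases huy with h | h0
    · exact Or.inl h
    · right
      have : flux N a u y * v y = 0 := by
        have : flux N a u y * v y - u y * flux N b v y = 0 := by linarith
        rwa [h0, zero_mul, sub_zero] at this
      exact (mul_eq_zero.1 this).resolve_left (hu.flux_neg_right hx hxy hy hup h0).ne

lemma norm_sub_le (h : BoundedSolution N a u) {ε : ℝ} (hε : 0 < ε) :
    ∃ K, ∀ x y, ε ≤ x → x ≤ y → y ≤ 1 →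
      |u y - u x| + |flux N a u y - flux N a u x| ≤
        K * ∫ s in x..y, (|u s| + |flux N a u s|) := by
  obtain ⟨C, hC⟩ := h.bdd
  have hC0 : 0 ≤ C := (h.nonneg 0).trans (hC 0)
  refine ⟨1 / ε ^ (N - 1) + C, fun x y hx hxy hy => ?_⟩
  have hx0 : 0 < x := hε.trans_le hx
  have hsub : Icc x y ⊆ Icc 0 1 := Icc_subset_Icc hx0.le hy
  have hcu := h.cont.mono hsub
  have hcf := h.flux_cont.mono hsub
  have hi : IntervalIntegrable (fun s => |u s| + |flux N a u s|) volume x y :=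
    ContinuousOn.intervalIntegrable_of_Icc hxy (hcu.abs.add hcf.abs)
  rw [add_mul, ← intervalIntegral.integral_const_mul, ← intervalIntegral.integral_const_mul]
  refine add_le_add ?_ ?_
  · rw [← intervalIntegral.integral_eq_sub_of_hasDerivAt_of_le hxy hcu
      (fun s hs => h.deriv s ⟨hx0.trans hs.1, hs.2.le.trans hy⟩)
      (ContinuousOn.intervalIntegrable_of_Icc hxy (hcf.div (by fun_prop)
        fun s hs => (pow_pos (hx0.trans_le hs.1) _).ne')), ← Real.norm_eq_abs]
    refine intervalIntegral.norm_integral_le_of_norm_le hxy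
      (Eventually.of_forall fun s hs => ?_) (hi.const_mul _)
    have hp : ε ^ (N - 1) ≤ s ^ (N - 1) := pow_le_pow_left₀ hε.le (hx.trans hs.1.le) _
    have hp' : 0 < ε ^ (N - 1) := pow_pos hε _
    rw [norm_div, Real.norm_eq_abs, Real.norm_of_nonneg (hp'.le.trans hp), one_div_mul_eq_div]
    have := abs_nonneg (u s)
    gcongr
    linarith
  · rw [h.flux_sub (hsub ⟨le_rfl, hxy⟩) (hsub ⟨hxy, le_rfl⟩), abs_neg, ← Real.norm_eq_abs]
    refine intervalIntegral.norm_integral_le_of_norm_le hxy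
      (Eventually.of_forall fun s hs => ?_) (hi.const_mul _)
    have hs0 : 0 ≤ s := hx0.le.trans hs.1.le
    have hp : s ^ (N - 1) ≤ 1 := pow_le_one₀ hs0 (hs.2.trans hy)
    rw [norm_mul, norm_mul, norm_pow, Real.norm_of_nonneg hs0, Real.norm_of_nonneg (h.nonneg s),
      Real.norm_eq_abs]
    calc s ^ (N - 1) * a s * |u s| ≤ 1 * C * |u s| := by
          have := h.nonneg s
          have := hC s
          gcongr
      _ ≤ C * (|u s| + |flux N a u s|) := by
          rw [one_mul]
          gcongr
          linarith [abs_nonneg (flux N a u s)]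

/-- Unique continuation from an interval. -/
lemma eq_zero_of_eq_zero_on (h : BoundedSolution N a u) {x y : ℝ} (hx : 0 ≤ x) (hxy : x < y)
    (hy : y ≤ 1) (hu : ∀ s ∈ Ioo x y, u s = 0) : ∀ r ∈ Icc (0:ℝ) 1, u r = 0 := by
  obtain ⟨c, hc⟩ : ∃ c, c ∈ Ioo x y := nonempty_Ioo.2 hxy
  have hc0 : 0 < c := hx.trans_lt hc.1
  have hc1 : c < 1 := hc.2.trans_le hy
  have huc := hu c hc
  have hfc : flux N a u c = 0 := by
    have h1 : HasDerivAt u 0 c := (hasDerivAt_const c (0:ℝ)).congr_of_eventuallyEq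
      ((Ioo_mem_nhds hc.1 hc.2 |> eventually_of_mem) hu)
    have h2 := (h.deriv c ⟨hc0, hc1.le⟩).unique h1
    exact (div_eq_zero_iff.1 h2).resolve_right (pow_pos hc0 _).ne'
  have hpos : ∀ r ∈ Ioc (0:ℝ) 1, u r = 0 := by
    intro r hr
    have hε : 0 < min r c := lt_min hr.1 hc0
    obtain ⟨K, hK⟩ := h.norm_sub_le hε
    have hcont : ContinuousOn (fun s => |u s| + |flux N a u s|) (Icc 0 1) :=
      h.cont.abs.add h.flux_cont.abs
    have hzero : |u r| + |flux N a u r| = 0 := by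
      rcases le_total c r with hcr | hcr
      · refine eq_zero_of_le_integral (x := c) (y := 1) (C := K)
          (h := fun s => |u s| + |flux N a u s|)
          (hcont.mono (Icc_subset_Icc hc0.le le_rfl))
          (fun s _ => by positivity) (fun s hs => ?_) r ⟨hcr, hr.2⟩
        simpa [huc, hfc] using hK c s (min_le_right _ _) hs.1 hs.2
      · refine eq_zero_of_le_integral_left (x := r) (y := c) (C := K)
          (h := fun s => |u s| + |flux N a u s|)
          (hcont.mono (Icc_subset_Icc hr.1.le hc1.le))
          (fun s _ => by positivity) (fun s hs => ?_) r ⟨le_rfl, hcr⟩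
        simpa [huc, hfc] using hK s c ((min_le_left _ _).trans hs.1) hs.2 hc1.le
    exact abs_eq_zero.1 (by linarith [abs_nonneg (u r), abs_nonneg (flux N a u r)])
  intro r hr
  have hcl : closure (Ioc (0:ℝ) 1) = Icc 0 1 := closure_Ioc zero_ne_one
  rw [← hcl] at hr
  have := le_on_closure (f := fun s => |u s|) (g := fun _ => 0)
    (fun s hs => (by rw [hpos s hs, abs_zero] : |u s| ≤ 0)) (by rw [hcl]; exact h.cont.abs)
    continuousOn_const hr
  exact abs_nonpos_iff.1 this

end BoundedSolution

lemma pos_or_neg_of_ne_zero {f : ℝ → ℝ} {x y : ℝ} (hf : ContinuousOn f (Ioo x y))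
    (h0 : ∀ s ∈ Ioo x y, f s ≠ 0) : (∀ s ∈ Ioo x y, 0 < f s) ∨ ∀ s ∈ Ioo x y, 0 < -f s := by
  by_contra! hcon
  obtain ⟨⟨s, hs, hfs⟩, t, ht, hft⟩ := hcon
  obtain ⟨r, hr, hfr⟩ := isPreconnected_Ioo.intermediate_value hs ht hf
    ⟨hfs, by linarith⟩
  exact h0 r hr hfr

/-- The arch of a continuous function around a point where it does not vanish. -/
lemma exists_arch {f : ℝ → ℝ} {x y c : ℝ} (hf : ContinuousOn f (Icc x y)) (hc : c ∈ Ioo x y)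
    (h0 : f c ≠ 0) : ∃ x' y', x ≤ x' ∧ x' < c ∧ c < y' ∧ y' ≤ y ∧ (x' = x ∨ f x' = 0) ∧
      (y' = y ∨ f y' = 0) ∧ ∀ s ∈ Ioo x' y', f s ≠ 0 := by
  have hl : IsCompact (insert x (Icc x c ∩ f ⁻¹' {0})) :=
    (isCompact_Icc.of_isClosed_subset ((hf.mono (Icc_subset_Icc le_rfl hc.2.le)
      ).preimage_isClosed_of_isClosed isClosed_Icc isClosed_singleton) inter_subset_left).insert x
  have hr : IsCompact (insert y (Icc c y ∩ f ⁻¹' {0})) :=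
    (isCompact_Icc.of_isClosed_subset ((hf.mono (Icc_subset_Icc hc.1.le le_rfl)
      ).preimage_isClosed_of_isClosed isClosed_Icc isClosed_singleton) inter_subset_left).insert y
  obtain ⟨x', hx', hxg⟩ := hl.exists_isGreatest (insert_nonempty _ _)
  obtain ⟨y', hy', hyl⟩ := hr.exists_isLeast (insert_nonempty _ _)
  have hx1 : x ≤ x' := hxg (mem_insert _ _)
  have hy1 : y' ≤ y := hyl (mem_insert _ _)
  have hx2 : x' < c := by
    rcases hx' with rfl | ⟨hm, hz⟩
    · exact hc.1
    · exact lt_of_le_of_ne hm.2 fun e => h0 (e ▸ hz)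
  have hy2 : c < y' := by
    rcases hy' with rfl | ⟨hm, hz⟩
    · exact hc.2
    · exact lt_of_le_of_ne hm.1 fun e => h0 (e ▸ hz)
  refine ⟨x', y', hx1, hx2, hy2, hy1, hx'.imp id And.right, hy'.imp id And.right, ?_⟩
  intro s hs hz
  rcases le_total s c with hsc | hsc
  · exact absurd (hxg (Or.inr ⟨⟨hx1.trans hs.1.le, hsc⟩, hz⟩)) (not_le.2 hs.1)
  · exact absurd (hyl (Or.inr ⟨⟨hsc, hs.2.le.trans hy1⟩, hz⟩)) (not_le.2 hs.2)

/-- `f` has `m` distinct zeros in `(0,1)`, listed increasingly as `w 1 < ⋯ < w m` and framed by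
`w 0 = 0` and `w (m + 1) = 1`. -/
def HasInteriorZeros (f : ℝ → ℝ) (m : ℕ) : Prop :=
  ∃ w : ℕ → ℝ, w 0 = 0 ∧ w (m + 1) = 1 ∧ (∀ i ≤ m, w i < w (i + 1)) ∧
    ∀ i, 1 ≤ i → i ≤ m → f (w i) = 0

lemma le_of_step_lt {w : ℕ → ℝ} {m : ℕ} (hw : ∀ i ≤ m, w i < w (i + 1)) {i j : ℕ} (hij : i ≤ j)
    (hj : j ≤ m + 1) : w i ≤ w j := by
  induction j, hij using Nat.le_induction with
  | base => exact le_rfl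
  | succ j _ ih => exact (ih (by omega)).trans (hw j (by omega)).le

namespace BoundedSolution

variable {N : ℕ} {a b u v : ℝ → ℝ}

/-- Sturm comparison between two zeros of `u`, the endpoints `0` and `1` counting as zeros. -/
lemma sturm (hu : BoundedSolution N a u) (hv : BoundedSolution N b v)
    (hab : ∀ r, a r ≤ b r) (hne : NontrivialSol u) {x y : ℝ} (hx : 0 ≤ x) (hxy : x < y)
    (hy : y ≤ 1) (hux : x = 0 ∨ u x = 0) (huy : y = 1 ∨ u y = 0) :
    (∃ z ∈ Ioo x y, v z = 0) ∨
    (∀ᵐ r ∂volume.restrict (Ioc x y), a r = b r) ∧ (x = 0 ∨ v x = 0) ∧ (y = 1 ∨ v y = 0) := by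
  by_contra! hcon
  obtain ⟨hvz, hcon⟩ := hcon
  obtain ⟨c, hc, huc⟩ : ∃ c ∈ Ioo x y, u c ≠ 0 := by
    by_contra! h0
    obtain ⟨r, hr, hur⟩ := hne
    exact hur (hu.eq_zero_of_eq_zero_on hx hxy hy h0 r hr)
  have hsub : Icc x y ⊆ Icc 0 1 := Icc_subset_Icc hx hy
  obtain ⟨x', y', hx1, hx2, hy2, hy1, hx3, hy3, hu0⟩ := exists_arch (hu.cont.mono hsub) hc huc
  have hx0 : 0 ≤ x' := hx.trans hx1
  have hy0 : y' ≤ 1 := hy1.trans hy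
  have hxy' : x' < y' := hx2.trans hy2
  have hsub' : Ioo x' y' ⊆ Icc 0 1 := Ioo_subset_Icc_self.trans (Icc_subset_Icc hx0 hy0)
  have hv0 : ∀ s ∈ Ioo x' y', v s ≠ 0 := fun s hs => hvz s ⟨hx1.trans_lt hs.1, hs.2.trans_le hy1⟩
  have hux' : x' = 0 ∨ u x' = 0 := by
    rcases hx3 with rfl | h
    · exact hux
    · exact Or.inr h
  have huy' : y' = 1 ∨ u y' = 0 := by
    rcases hy3 with rfl | h
    · exact huy
    · exact Or.inr h
  have key : (∀ᵐ r ∂volume.restrict (Ioc x' y'), a r = b r) ∧ (x' = 0 ∨ v x' = 0) ∧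
      (y' = 1 ∨ v y' = 0) := by
    rcases pos_or_neg_of_ne_zero (hu.cont.mono hsub') hu0 with hup | hup <;>
    rcases pos_or_neg_of_ne_zero (hv.cont.mono hsub') hv0 with hvp | hvp
    · exact hu.sturm_of_pos hv hab hx0 hxy' hy0 hup hvp hux' huy'
    · simpa using hu.sturm_of_pos hv.neg hab hx0 hxy' hy0 hup hvp hux' huy'
    · simpa using hu.neg.sturm_of_pos hv hab hx0 hxy' hy0 hup hvp (by simpa using hux')
        (by simpa using huy')
    · simpa using hu.neg.sturm_of_pos hv.neg hab hx0 hxy' hy0 hup hvp (by simpa using hux')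
        (by simpa using huy')
  obtain ⟨k1, k2, k3⟩ := key
  have hxx : x' = x := by
    by_contra hxx
    have hlt := lt_of_le_of_ne hx1 (Ne.symm hxx)
    exact hvz x' ⟨hlt, hxy'.trans_le hy1⟩ (k2.resolve_left (hx.trans_lt hlt).ne')
  have hyy : y' = y := by
    by_contra hyy
    have hlt := lt_of_le_of_ne hy1 hyy
    exact hvz y' ⟨hx1.trans_lt hxy', hlt⟩ (k3.resolve_left (hlt.trans_le hy).ne)
  subst hxx hyy
  have := hcon k1 (by tauto)
  tauto

/-- Increasing the potential on a set of positive measure gains at least one zero. -/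
lemma hasInteriorZeros_succ (hu : BoundedSolution N a u) (hv : BoundedSolution N b v)
    (hab : ∀ r, a r ≤ b r) (hne : NontrivialSol u) {m : ℕ} (hz : HasInteriorZeros u m)
    (hdiff : ¬ ∀ᵐ r ∂volume.restrict (Ioo (0:ℝ) 1), a r = b r) : HasInteriorZeros v (m + 1) := by
  obtain ⟨w, hw0, hw1, hw, huw⟩ := hz
  have hwnn : ∀ i ≤ m + 1, 0 ≤ w i := fun i hi => hw0 ▸ le_of_step_lt hw (Nat.zero_le i) hi
  have hwle : ∀ i ≤ m + 1, w i ≤ 1 := fun i hi => hw1 ▸ le_of_step_lt hw hi le_rfl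
  have hst : ∀ i ≤ m, (∃ z ∈ Ioo (w i) (w (i + 1)), v z = 0) ∨
      (∀ᵐ r ∂volume.restrict (Ioc (w i) (w (i + 1))), a r = b r) ∧ (w i = 0 ∨ v (w i) = 0) ∧
        (w (i + 1) = 1 ∨ v (w (i + 1)) = 0) := by
    intro i hi
    refine hu.sturm hv hab hne (hwnn i (by omega)) (hw i hi) (hwle _ (by omega)) ?_ ?_
    · rcases Nat.eq_zero_or_pos i with rfl | hi'
      · exact Or.inl hw0
      · exact Or.inr (huw i hi' hi)
    · rcases hi.eq_or_lt with rfl | hi'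
      · exact Or.inl hw1
      · exact Or.inr (huw _ (by omega) (by omega))
  obtain ⟨j, hj, hjz⟩ : ∃ j ≤ m, ∃ z ∈ Ioo (w j) (w (j + 1)), v z = 0 := by
    by_contra hcon
    refine hdiff ?_
    have hall : ∀ i ≤ m + 1, ∀ᵐ r ∂volume.restrict (Ioc 0 (w i)), a r = b r := by
      intro i
      induction i with
      | zero => simp [hw0]
      | succ i ih =>
        intro hi
        rw [← Ioc_union_Ioc_eq_Ioc (hwnn i (by omega)) (hw i (by omega)).le,
          ae_restrict_union_iff]
        exact ⟨ih (by omega), ((hst i (by omega)).resolve_left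
          fun h => hcon ⟨i, by omega, h⟩).1⟩
    have := hall (m + 1) le_rfl
    rwa [hw1, ← restrict_Ioo_eq_restrict_Ioc] at this
  have hc : ∀ i, ∃ c, i ≤ m → v c = 0 ∧ w i ≤ c ∧ c ≤ w (i + 1) ∧ (i ≤ j → w i < c) ∧
      (j ≤ i → c < w (i + 1)) := by
    intro i
    by_cases hi : i ≤ m
    swap
    · exact ⟨0, fun h => absurd h hi⟩
    have hwi := hw i hi
    by_cases hiz : ∃ z ∈ Ioo (w i) (w (i + 1)), v z = 0
    · obtain ⟨z, hz, hvz⟩ := hiz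
      exact ⟨z, fun _ => ⟨hvz, hz.1.le, hz.2.le, fun _ => hz.1, fun _ => hz.2⟩⟩
    · obtain ⟨-, h1, h2⟩ := (hst i hi).resolve_left hiz
      rcases lt_trichotomy i j with hij | rfl | hij
      · refine ⟨w (i + 1), fun _ => ⟨h2.resolve_left ?_, hwi.le, le_rfl, fun _ => hwi,
          fun h => absurd h (by omega)⟩⟩
        exact ((hw (i + 1) (by omega)).trans_le (hwle _ (by omega))).ne
      · exact absurd hjz hiz
      · refine ⟨w i, fun _ => ⟨h1.resolve_left ?_, le_rfl, hwi.le,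
          fun h => absurd h (by omega), fun _ => hwi⟩⟩
        obtain ⟨l, rfl⟩ : ∃ l, i = l + 1 := ⟨i - 1, by omega⟩
        exact ((hwnn l (by omega)).trans_lt (hw l (by omega))).ne'
  choose c hc using hc
  refine ⟨fun n => if n = 0 then 0 else if n ≤ m + 1 then c (n - 1) else 1, by simp, by simp,
    ?_, ?_⟩
  · intro i hi
    rcases Nat.eq_zero_or_pos i with rfl | hi0
    · have := (hc 0 (Nat.zero_le _)).2.2.2.1 (Nat.zero_le _)
      simpa [hw0] using this
    obtain ⟨l, rfl⟩ : ∃ l, i = l + 1 := ⟨i - 1, by omega⟩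
    have hl := hc l (by omega)
    rcases hi.eq_or_lt with hi' | hi'
    · have : l = m := by omega
      subst this
      have := hl.2.2.2.2 hj
      simpa [hw1] using this
    · have hl' := hc (l + 1) (by omega)
      have : c l < c (l + 1) := by
        rcases Nat.lt_or_ge l j with h | h
        · exact hl.2.2.1.trans_lt (hl'.2.2.2.1 h)
        · exact (hl.2.2.2.2 h).trans_le hl'.2.1
      have h1 : l + 1 ≤ m := by omega
      have h2 : l ≤ m := by omega
      simpa [h1, h2] using this
  · intro i hi hi'
    have h1 : i ≠ 0 := by omega
    simp only [h1, hi', if_true, if_false]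
    exact (hc (i - 1) (by omega)).1

end BoundedSolution

/-- Modifying the potential on a null set turns a radial Neumann solution into a
`BoundedSolution`. -/
lemma IsRadialNeumannSolution.boundedSolution {N : ℕ} {a a' u : ℝ → ℝ}
    (h : IsRadialNeumannSolution N a u)
    (haa : ∀ᵐ r ∂volume.restrict (Ioo (0:ℝ) 1), a r = a' r) (hm : Measurable a')
    (h0 : ∀ r, 0 ≤ a' r) (hb : ∃ C, ∀ r, a' r ≤ C) : BoundedSolution N a' u := by
  obtain ⟨u', hc, hd, hf, h1⟩ := h
  have hflux : ∀ r ∈ Ioc (0:ℝ) 1, r ^ (N - 1) * u' r = flux N a' u r := by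
    intro r hr
    rw [hf r hr, flux, intervalIntegral.integral_of_le hr.1.le,
      intervalIntegral.integral_of_le hr.1.le]
    congr 1
    refine integral_congr_ae ?_
    rw [restrict_Ioo_eq_restrict_Ioc] at haa
    filter_upwards [ae_restrict_of_ae_restrict_of_subset
      (Ioc_subset_Ioc le_rfl hr.2 : Ioc 0 r ⊆ Ioc 0 1) haa] with s hs
    rw [hs]
  refine ⟨hm, h0, hb, hc, fun r hr => ?_, ?_⟩
  · rw [← hflux r hr, mul_div_cancel_left₀ _ (pow_pos hr.1 _).ne']
    exact hd r hr
  · rw [← hflux 1 (by simp), h1, mul_zero]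

namespace IsRadialNeumannEigenpair

variable {N k : ℕ} {μ : ℝ} {φ : ℝ → ℝ} {rz : ℕ → ℝ}

lemma boundedSolution (h : IsRadialNeumannEigenpair N k μ φ rz) :
    BoundedSolution N (fun _ => μ) φ :=
  h.2.1.boundedSolution (Eventually.of_forall fun _ => rfl) measurable_const (fun _ => h.1)
    ⟨μ, fun _ => le_rfl⟩

lemma hasInteriorZeros (h : IsRadialNeumannEigenpair N k μ φ rz) : HasInteriorZeros φ k := by
  obtain ⟨-, -, -, hmem, hlt, hz, -⟩ := h
  refine ⟨fun n => if n = 0 then 0 else if n ≤ k then rz (k + 1 - n) else 1, by simp, by simp,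
    ?_, ?_⟩
  · intro i hi
    rcases Nat.eq_zero_or_pos i with rfl | hi0
    · rcases Nat.eq_zero_or_pos k with rfl | hk
      · simp
      · have := (hmem k hk le_rfl).1
        have h1 : 1 ≤ k := hk
        simpa [h1] using this
    · have h0 : i ≠ 0 := by omega
      rcases hi.eq_or_lt with rfl | hi'
      · have := (hmem 1 le_rfl hi0).2
        simpa [h0] using this
      · have := hlt (k + 1 - (i + 1)) (k + 1 - i) (by omega) (by omega) (by omega)
        have h1 : i + 1 ≤ k := hi'
        simpa [h0, hi, h1] using this
  · intro i hi hi'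
    have h1 : i ≠ 0 := by omega
    simp only [h1, hi', if_true, if_false]
    exact (hz _ (hmem _ (by omega) (by omega))).2 ⟨k + 1 - i, by omega, by omega, rfl⟩

lemma not_hasInteriorZeros_succ (h : IsRadialNeumannEigenpair N k μ φ rz) :
    ¬ HasInteriorZeros φ (k + 1) := by
  rintro ⟨w, hw0, hw1, hw, hφ⟩
  obtain ⟨-, -, -, -, -, hz, -⟩ := h
  have hlt : ∀ i j, i < j → j ≤ k + 2 → w i < w j := fun i j hij hj =>
    (hw i (by omega)).trans_le (le_of_step_lt hw hij hj)
  have hex : ∀ i, ∃ l, 1 ≤ i → i ≤ k + 1 → l ∈ Finset.Icc 1 k ∧ w i = rz l := by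
    intro i
    by_cases hi : 1 ≤ i ∧ i ≤ k + 1
    · obtain ⟨l, h1, h2, h3⟩ := (hz (w i) ⟨hw0 ▸ hlt 0 i hi.1 (by omega),
        hw1 ▸ hlt i (k + 2) (by omega) le_rfl⟩).1 (hφ i hi.1 hi.2)
      exact ⟨l, fun _ _ => ⟨Finset.mem_Icc.2 ⟨h1, h2⟩, h3⟩⟩
    · exact ⟨0, fun h1 h2 => absurd ⟨h1, h2⟩ hi⟩
  choose l hl using hex
  obtain ⟨i, hi, j, hj, hij, hlij⟩ := Finset.exists_ne_map_eq_of_card_lt_of_maps_to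
    (s := Finset.Icc 1 (k + 1)) (t := Finset.Icc 1 k) (f := l) (by simp)
    (fun i hi => by
      have := Finset.mem_Icc.1 (Finset.mem_coe.1 hi)
      exact Finset.mem_coe.2 (hl i this.1 this.2).1)
  rw [Finset.mem_Icc] at hi hj
  have heq : w i = w j := by rw [(hl i hi.1 hi.2).2, (hl j hj.1 hj.2).2, hlij]
  rcases lt_or_gt_of_ne hij with h' | h'
  · exact (hlt i j h' (by omega)).ne heq
  · exact (hlt j i h' (by omega)).ne' heq

/-- A potential between two consecutive eigenvalues with a nontrivial solution
is constant, equal to one of them. -/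
lemma ae_eq_of_between {μ' : ℝ} {φ' a u : ℝ → ℝ} {rz' : ℕ → ℝ}
    (h : IsRadialNeumannEigenpair N k μ φ rz)
    (h' : IsRadialNeumannEigenpair N (k + 1) μ' φ' rz') (hle : μ ≤ μ') (hm : Measurable a)
    (hsol : IsRadialNeumannSolution N a u) (hne : NontrivialSol u)
    (hlow : ∀ᵐ r ∂volume.restrict (Ioo (0:ℝ) 1), μ ≤ a r)
    (hup : ∀ᵐ r ∂volume.restrict (Ioo (0:ℝ) 1), a r ≤ μ') :
    (∀ᵐ r ∂volume.restrict (Ioo (0:ℝ) 1), μ = a r) ∨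
      ∀ᵐ r ∂volume.restrict (Ioo (0:ℝ) 1), a r = μ' := by
  have hclamp : ∀ᵐ r ∂volume.restrict (Ioo (0:ℝ) 1), a r = max μ (min (a r) μ') := by
    filter_upwards [hlow, hup] with r h1 h2
    rw [min_eq_left h2, max_eq_right h1]
  have hu := hsol.boundedSolution hclamp (by fun_prop) (fun r => h.1.trans (le_max_left _ _))
    ⟨μ', fun r => max_le hle (min_le_right _ _)⟩
  by_contra hcon
  rw [not_or] at hcon
  refine h'.not_hasInteriorZeros_succ (hu.hasInteriorZeros_succ h'.boundedSolution
    (fun r => max_le hle (min_le_right _ _)) hne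
    (h.boundedSolution.hasInteriorZeros_succ hu (fun r => le_max_left _ _) h.2.2.1
      h.hasInteriorZeros fun hae => hcon.1 ?_) fun hae => hcon.2 ?_)
  · filter_upwards [hae, hclamp] with r h1 h2
    rw [h2]
    exact h1
  · filter_upwards [hae, hclamp] with r h1 h2
    rw [h2]
    exact h1

end IsRadialNeumannEigenpair

lemma RadialMemLinfty.ae_le_radialLinftyNorm_sub {a : ℝ → ℝ} (ha : RadialMemLinfty a) (μ : ℝ) :
    ∀ᵐ r ∂volume.restrict (Ioo (0:ℝ) 1), a r ≤ μ + radialLinftyNorm (fun r => a r - μ) := by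
  obtain ⟨C, hC⟩ := ha
  have hbdd : IsBoundedUnder (· ≤ ·) (ae (volume.restrict (Ioo (0:ℝ) 1)))
      fun r => |a r - μ| :=
    isBoundedUnder_of_eventually_le (a := C + |μ|) <| by
      filter_upwards [hC] with r hr
      exact (abs_sub _ _).trans (add_le_add_left hr _)
  filter_upwards [ae_le_essSup hbdd] with r hr
  have h1 := (le_abs_self _).trans hr
  unfold radialLinftyNorm
  linarith

lemma radialLinftyNorm_const {c : ℝ} (hc : 0 ≤ c) : radialLinftyNorm (fun _ => c) = c := by
  have hne : volume.restrict (Ioo (0:ℝ) 1) ≠ 0 := by simp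
  rw [radialLinftyNorm, essSup_const _ hne, abs_of_nonneg hc]

lemma gammaSet_const {N k : ℕ} {ν μ : ℝ} {φ : ℝ → ℝ} {rz : ℕ → ℝ}
    (h : IsRadialNeumannEigenpair N k μ φ rz) (hlt : ν < μ) : GammaSet N ν fun _ => μ := by
  refine ⟨measurable_const, ⟨Eventually.of_forall fun _ => hlt.le, ?_⟩, ⟨φ, h.2.1, h.2.2.1⟩, ?_⟩
  · have : {r ∈ Ioo (0:ℝ) 1 | ν < μ} = Ioo 0 1 := by ext; simp [hlt]
    rw [this]
    simp
  · split_ifs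
    · refine IntegrableOn.mono_set (ContinuousOn.integrableOn_Icc ?_) Ioo_subset_Icc_self
      exact (continuous_pow _).continuousOn.mul continuousOn_const
    · exact Or.inr ⟨|μ|, Eventually.of_forall fun _ => le_rfl⟩

/-- An element of `Γ_k` below the next eigenvalue is equal to this eigenvalue. -/
lemma GammaSet.ae_eq_of_le {N k : ℕ} {μ μ' : ℝ} {φ φ' a : ℝ → ℝ} {rz rz' : ℕ → ℝ}
    (ha : GammaSet N μ a) (h : IsRadialNeumannEigenpair N k μ φ rz)
    (h' : IsRadialNeumannEigenpair N (k + 1) μ' φ' rz') (hle : μ ≤ μ')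
    (hup : ∀ᵐ r ∂volume.restrict (Ioo (0:ℝ) 1), a r ≤ μ') :
    ∀ᵐ r ∂volume.restrict (Ioo (0:ℝ) 1), a r = μ' := by
  obtain ⟨hm, ⟨hlow, hpos⟩, ⟨u, hsol, hne⟩, -⟩ := ha
  refine (h.ae_eq_of_between h' hle hm hsol hne hlow hup).resolve_left fun hae => hpos.ne' ?_
  refine measure_mono_null (fun r hr => ?_) ((ae_restrict_iff' measurableSet_Ioo).1 hae)
  exact fun hr' => hr.2.ne (hr' hr.1)

/-- The case `p = ∞`: `γ_{∞,k} = μ_{k+1} - μ_k`, attained at the constant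
function `a₀ ≡ μ_{k+1} ∈ Γ_k`, which is the unique minimizer. -/
theorem stmt13 (N k : ℕ) (hN : 2 ≤ N)
    (μk μk1 : ℝ) (φk φk1 : ℝ → ℝ) (rz rz1 : ℕ → ℝ)
    (hek : IsRadialNeumannEigenpair N k μk φk rz)
    (hek1 : IsRadialNeumannEigenpair N (k + 1) μk1 φk1 rz1)
    (hlt : μk < μk1) :
    gammaLyapInfty N μk = μk1 - μk ∧
    GammaSet N μk (fun _ => μk1) ∧
    radialLinftyNorm (fun _ => μk1 - μk) = μk1 - μk ∧
    (∀ a : ℝ → ℝ, GammaSet N μk a → RadialMemLinfty a →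
      radialLinftyNorm (fun r => a r - μk) = μk1 - μk →
      ∀ᵐ r ∂(volume.restrict (Ioo (0:ℝ) 1)), a r = μk1) := by
  have hmem := gammaSet_const hek1 hlt
  have hnorm := radialLinftyNorm_const (sub_nonneg.2 hlt.le)
  refine ⟨IsLeast.csInf_eq ⟨⟨_, hmem, ⟨|μk1|, Eventually.of_forall fun _ => le_rfl⟩, hnorm.symm⟩,
    ?_⟩, hmem, hnorm, fun a ha hinf heq => ?_⟩
  · rintro _ ⟨a, ha, hinf, rfl⟩
    by_contra! hcon
    have hle := hinf.ae_le_radialLinftyNorm_sub μk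
    have hae := ha.ae_eq_of_le hek hek1 hlt.le (hle.mono fun r hr => by linarith)
    have : (ae (volume.restrict (Ioo (0:ℝ) 1))).NeBot := by
      rw [ae_neBot]
      simp
    obtain ⟨r, h1, h2⟩ := (hle.and hae).exists
    linarith
  · refine ha.ae_eq_of_le hek hek1 hlt.le ?_
    filter_upwards [hinf.ae_le_radialLinftyNorm_sub μk] with r hr
    linarith
end
end

section
/- Let N ≥ 2, p > N/2 and M > 0. Then there exists ε = ε(N,p,M) > 0 with the following property: for every radial a ∈ L^p(B_1) satisfying ‖a‖_{L^p(B_1)} ≤ M and every nontrivial radial H^1 solution u of Δu + a u = 0 in B_1, every zero z ∈ (0,1] of u satisfies z > ε. -/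
open MeasureTheory Set Filter

noncomputable section

/-- Mean value inequality with an integrable majorant of the derivative. -/
theorem abs_sub_le_integral_of_abs_deriv_le {g g' φ : ℝ → ℝ} {x y : ℝ} (hxy : x ≤ y)
    (hcont : ContinuousOn g (Icc x y)) (hderiv : ∀ t ∈ Ioo x y, HasDerivAt g (g' t) t)
    (hφ : IntegrableOn φ (Icc x y)) (hle : ∀ t ∈ Ioo x y, |g' t| ≤ φ t) :
    |g y - g x| ≤ ∫ t in x..y, φ t := by
  rw [abs_le]
  constructor
  · have := intervalIntegral.sub_le_integral_of_hasDeriv_right_of_le hxy hcont.neg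
      (fun t ht => (hderiv t ht).neg.hasDerivWithinAt) hφ
      (fun t ht => (neg_le_abs _).trans (hle t ht))
    simp only [Pi.neg_apply] at this
    linarith
  · exact intervalIntegral.sub_le_integral_of_hasDeriv_right_of_le hxy hcont
      (fun t ht => (hderiv t ht).hasDerivWithinAt) hφ
      (fun t ht => (le_abs_self _).trans (hle t ht))

theorem natPow_pred_eq_rpow {N : ℕ} (hN : 2 ≤ N) (t : ℝ) :
    t ^ (N - 1) = t ^ ((N : ℝ) - 1) := by
  rw [← Real.rpow_natCast, Nat.cast_sub (by omega), Nat.cast_one]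

/-- Splitting `x` according to whether it lies below or above the level `t ^ (-κ)`. -/
theorem le_rpow_neg_add_rpow_mul {x t p κ : ℝ} (hx : 0 ≤ x) (ht : 0 < t) (hp : 1 ≤ p) :
    x ≤ t ^ (-κ) + x ^ p * t ^ (κ * (p - 1)) := by
  rcases le_or_gt x (t ^ (-κ)) with h | h
  · have : 0 ≤ x ^ p * t ^ (κ * (p - 1)) := by positivity
    linarith
  · have hx0 : 0 < x := lt_trans (by positivity) h
    have h1 : 1 ≤ x * t ^ κ := by
      have := mul_le_mul_of_nonneg_right h.le (by positivity : 0 ≤ t ^ κ)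
      rwa [← Real.rpow_add ht, neg_add_cancel, Real.rpow_zero] at this
    have h2 : 1 ≤ (x * t ^ κ) ^ (p - 1) := Real.one_le_rpow h1 (by linarith)
    have h3 : x * (x * t ^ κ) ^ (p - 1) = x ^ p * t ^ (κ * (p - 1)) := by
      rw [Real.mul_rpow hx (by positivity), ← Real.rpow_mul ht.le, ← mul_assoc]
      congr 1
      rw [Real.rpow_sub_one hx0.ne']
      field_simp
    have h4 : 0 ≤ t ^ (-κ) := by positivity
    nlinarith

theorem weighted_potential_le {N : ℕ} (hN : 2 ≤ N) {p σ t x : ℝ} (hp : 1 ≤ p)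
    (hσ : 2 * σ = N - N / p) (ht : 0 < t) (hx : 0 ≤ x) :
    t ^ (N - 1) * x * t ^ (-σ) ≤ t ^ (σ - 1) + t ^ σ * (t ^ (N - 1) * x ^ p) := by
  have hp0 : p ≠ 0 := by positivity
  have h := le_rpow_neg_add_rpow_mul (κ := N / p) hx ht hp
  have hw : 0 ≤ t ^ (N - 1) * t ^ (-σ) := by positivity
  have h' := mul_le_mul_of_nonneg_left h hw
  have e1 : t ^ (N - 1) * t ^ (-σ) * t ^ (-((N : ℝ) / p)) = t ^ (σ - 1) := by
    rw [natPow_pred_eq_rpow hN, ← Real.rpow_add ht, ← Real.rpow_add ht]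
    congr 1
    linarith
  have e2 : t ^ (-σ) * t ^ ((N : ℝ) / p * (p - 1)) = t ^ σ := by
    rw [← Real.rpow_add ht]
    congr 1
    have : (N : ℝ) / p * (p - 1) = N - N / p := by field_simp
    linarith
  calc t ^ (N - 1) * x * t ^ (-σ) = t ^ (N - 1) * t ^ (-σ) * x := by ring
    _ ≤ _ := h'
    _ = t ^ (N - 1) * t ^ (-σ) * t ^ (-((N : ℝ) / p))
        + (t ^ (-σ) * t ^ ((N : ℝ) / p * (p - 1))) * (t ^ (N - 1) * x ^ p) := by ring
    _ = _ := by rw [e1, e2]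

theorem RadialMemLp.intervalIntegrable {N : ℕ} {p : ℝ} {a : ℝ → ℝ} (ha : RadialMemLp N p a)
    {s r : ℝ} (hs : 0 ≤ s) (hsr : s ≤ r) (hr : r ≤ 1) :
    IntervalIntegrable (fun t => t ^ (N - 1) * |a t| ^ p) volume s r := by
  rw [intervalIntegrable_iff_integrableOn_Ioo_of_le hsr]
  exact IntegrableOn.mono_set ha (Ioo_subset_Ioo hs hr)

theorem RadialMemLp.integral_le {N : ℕ} {p : ℝ} {a : ℝ → ℝ} (ha : RadialMemLp N p a)
    {s r : ℝ} (hs : 0 ≤ s) (hsr : s ≤ r) (hr : r ≤ 1) :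
    ∫ t in s..r, t ^ (N - 1) * |a t| ^ p ≤ ∫ t in (0:ℝ)..1, t ^ (N - 1) * |a t| ^ p := by
  refine intervalIntegral.integral_mono_interval hs hsr hr ?_
    (ha.intervalIntegrable le_rfl zero_le_one le_rfl)
  refine (ae_restrict_iff' measurableSet_Ioc).2 (Eventually.of_forall fun t ht => ?_)
  have : 0 < t := ht.1
  simp only [Pi.zero_apply]
  positivity

theorem RadialMemLp.integrableOn_weight_mul_abs {N : ℕ} {p : ℝ} (hp : 1 ≤ p) {a : ℝ → ℝ}
    (hm : Measurable a) (ha : RadialMemLp N p a) :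
    IntegrableOn (fun t => t ^ (N - 1) * |a t|) (Ioo (0:ℝ) 1) := by
  have h1 : IntegrableOn (fun _ : ℝ => (1:ℝ)) (Ioo (0:ℝ) 1) := by simp
  refine Integrable.mono' (h1.add ha) (by fun_prop) ?_
  refine (ae_restrict_iff' measurableSet_Ioo).2 (Eventually.of_forall fun t ht => ?_)
  have ht0 : 0 < t := ht.1
  have hw : t ^ (N - 1) ≤ 1 := pow_le_one₀ ht0.le ht.2.le
  have hw0 : 0 ≤ t ^ (N - 1) := by positivity
  have h := le_rpow_neg_add_rpow_mul (κ := 0) (abs_nonneg (a t)) ht0 hp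
  simp only [neg_zero, Real.rpow_zero, zero_mul, mul_one] at h
  rw [Real.norm_of_nonneg (by positivity)]
  simp only [Pi.add_apply]
  nlinarith

theorem omegaN_pos {N : ℕ} (hN : 2 ≤ N) : 0 < omegaN N := by
  have : 0 < (volume (Metric.ball (0 : EuclideanSpace ℝ (Fin N)) 1)).toReal :=
    ENNReal.toReal_pos (Metric.measure_ball_pos _ _ one_pos).ne' measure_ball_lt_top.ne
  have hN' : (0:ℝ) < N := by positivity
  exact mul_pos hN' this

theorem integral_le_of_radialLpNorm_le {N : ℕ} (hN : 2 ≤ N) {p M : ℝ} (hp : 0 < p)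
    {a : ℝ → ℝ} (h : radialLpNorm N p a ≤ M) :
    ∫ t in (0:ℝ)..1, t ^ (N - 1) * |a t| ^ p ≤ M ^ p / omegaN N := by
  have hω := omegaN_pos hN
  have hI : 0 ≤ ∫ t in (0:ℝ)..1, t ^ (N - 1) * |a t| ^ p := by
    refine intervalIntegral.integral_nonneg zero_le_one fun t ht => ?_
    have : 0 ≤ t := ht.1
    positivity
  have h0 : 0 ≤ omegaN N * ∫ t in (0:ℝ)..1, t ^ (N - 1) * |a t| ^ p := by positivity
  have := Real.rpow_le_rpow (by unfold radialLpNorm; positivity) h hp.le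
  rw [radialLpNorm, one_div, Real.rpow_inv_rpow h0 hp.ne'] at this
  rw [le_div_iff₀ hω]
  linarith

namespace IsRadialH1Solution

variable {N : ℕ} {a u u' : ℝ → ℝ}

theorem abs_flux_sub_le (h : IsRadialH1Solution N a u u') {s r : ℝ} (hs : 0 < s) (hsr : s ≤ r)
    (hr : r < 1) {φ : ℝ → ℝ} (hφ : IntervalIntegrable φ volume s r)
    (hle : ∀ t ∈ Ioc s r, |t ^ (N - 1) * a t * u t| ≤ φ t) :
    |r ^ (N - 1) * u' r - s ^ (N - 1) * u' s| ≤ ∫ t in s..r, φ t := by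
  rcases hsr.eq_or_lt with rfl | hlt
  · simp
  rw [h.2.2.1 s ⟨hs, hlt.trans hr⟩ r ⟨hs.trans hlt, hr⟩ hlt, abs_neg, ← Real.norm_eq_abs]
  exact intervalIntegral.norm_integral_le_of_norm_le hsr (Eventually.of_forall hle) hφ

/-- The finite energy forces the flux `r ^ (N - 1) * u' r` to be small along a sequence tending
to the origin. -/
theorem exists_abs_flux_lt (h : IsRadialH1Solution N a u u') (hN : 2 ≤ N) {r η : ℝ} (hr : 0 < r)
    (hr1 : r ≤ 1) (hη : 0 < η) : ∃ s ∈ Ioo 0 r, |s ^ (N - 1) * u' s| < η := by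
  by_contra! hcon
  have hE : IntegrableOn (fun t => t ^ (N - 1) * ((u' t) ^ 2 + (u t) ^ 2)) (Ioo 0 r) :=
    h.2.2.2.mono_set (Ioo_subset_Ioo_right hr1)
  have hint : IntegrableOn (fun t : ℝ => t ^ (-1 : ℝ)) (Ioo 0 r) := by
    refine Integrable.mono' (hE.const_mul (η ^ 2)⁻¹) (by fun_prop) ?_
    refine (ae_restrict_iff' measurableSet_Ioo).2 (Eventually.of_forall fun t ht => ?_)
    have ht0 : 0 < t := ht.1
    have hw : t ^ (N - 1) ≤ t := by
      simpa using pow_le_pow_of_le_one ht0.le (ht.2.le.trans hr1) (by omega : 1 ≤ N - 1)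
    have hw0 : 0 < t ^ (N - 1) := by positivity
    have hsq : η ^ 2 ≤ (t ^ (N - 1) * u' t) ^ 2 := by
      rw [← sq_abs (t ^ (N - 1) * u' t)]
      exact pow_le_pow_left₀ hη.le (hcon t ht) 2
    rw [Real.norm_of_nonneg (by positivity), Real.rpow_neg_one, inv_mul_eq_div,
      inv_eq_one_div, div_le_div_iff₀ ht0 (by positivity)]
    have h1 : (t ^ (N - 1) * u' t) ^ 2 ≤ t * (t ^ (N - 1) * (u' t) ^ 2) := by
      have h2 : 0 ≤ t ^ (N - 1) * (u' t) ^ 2 := by positivity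
      nlinarith [mul_le_mul_of_nonneg_right hw h2]
    have h3 : 0 ≤ t * (t ^ (N - 1) * (u t) ^ 2) := by positivity
    nlinarith
  rw [intervalIntegral.integrableOn_Ioo_rpow_iff hr] at hint
  exact lt_irrefl _ hint

/-- Growth of a solution at the origin, measured from one of its zeros. -/
theorem exists_rpow_mul_abs_le (h : IsRadialH1Solution N a u u') (hN : 2 ≤ N) {σ z : ℝ}
    (hσ : 0 < σ) (hσN : (N : ℝ) - 2 < 2 * σ) (hz : z < 1) (huz : u z = 0) :
    ∃ B, ∀ r ∈ Ioo 0 z, r ^ σ * |u r| ≤ B := by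
  let E : ℝ → ℝ := fun t => t ^ (N - 1) * ((u' t) ^ 2 + (u t) ^ 2) + t ^ (2 * σ + 1 - N)
  have hEint : IntervalIntegrable E volume 0 1 := by
    refine IntervalIntegrable.add ?_ (intervalIntegral.intervalIntegrable_rpow' (by linarith))
    rw [intervalIntegrable_iff_integrableOn_Ioo_of_le zero_le_one]
    exact h.2.2.2
  have hEnn : ∀ t, 0 < t → 0 ≤ E t := fun t ht => by positivity
  refine ⟨∫ t in (0:ℝ)..1, E t, fun r hr => ?_⟩
  have hr0 : 0 < r := hr.1
  have hsub : Icc r z ⊆ Ioo 0 1 := fun t ht => ⟨hr0.trans_le ht.1, ht.2.trans_lt hz⟩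
  have hEr : IntegrableOn E (Icc r z) :=
    (((intervalIntegrable_iff_integrableOn_Ioo_of_le zero_le_one).1 hEint).mono_set hsub)
  have hrσ : 0 < r ^ σ := by positivity
  have key := abs_sub_le_integral_of_abs_deriv_le (g := u) (g' := u')
    (φ := fun t => (r ^ σ)⁻¹ * E t) hr.2.le
    (h.1.mono fun t ht => Ioo_subset_Ioc_self (hsub ht))
    (fun t ht => h.2.1 t (hsub (Ioo_subset_Icc_self ht))) (hEr.const_mul _) (fun t ht => by
      have ht0 : 0 < t := hr0.trans ht.1
      have hmono : r ^ σ ≤ t ^ σ := Real.rpow_le_rpow hr0.le ht.1.le hσ.le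
      have hw : 0 < t ^ (N - 1) := by positivity
      have hsq : t ^ (2 * σ + 1 - N) = (t ^ σ) ^ 2 / t ^ (N - 1) := by
        rw [natPow_pred_eq_rpow hN, ← Real.rpow_natCast, ← Real.rpow_mul ht0.le,
          ← Real.rpow_sub ht0]
        congr 1
        push_cast
        ring
      have hyoung : t ^ σ * |u' t| ≤ t ^ (N - 1) * (u' t) ^ 2 + t ^ (2 * σ + 1 - N) := by
        rw [hsq, ← sq_abs (u' t)]
        have hd : (t ^ σ) ^ 2 / t ^ (N - 1) = t ^ (N - 1) * (t ^ σ / t ^ (N - 1)) ^ 2 := by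
          field_simp
        have hm : t ^ σ * |u' t| = t ^ (N - 1) * ((t ^ σ / t ^ (N - 1)) * |u' t|) := by
          field_simp
        rw [hd, hm, ← mul_add]
        refine mul_le_mul_of_nonneg_left ?_ hw.le
        nlinarith [sq_nonneg (|u' t| - t ^ σ / t ^ (N - 1)), sq_nonneg (|u' t|),
          sq_nonneg (t ^ σ / t ^ (N - 1))]
      rw [inv_mul_eq_div, le_div_iff₀ hrσ]
      have h1 := mul_le_mul_of_nonneg_right hmono (abs_nonneg (u' t))
      have h2 : 0 ≤ t ^ (N - 1) * (u t) ^ 2 := by positivity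
      simp only [E]
      nlinarith)
  rw [huz, zero_sub, abs_neg, intervalIntegral.integral_const_mul, inv_mul_eq_div,
    le_div_iff₀ hrσ] at key
  rw [mul_comm]
  refine key.trans (intervalIntegral.integral_mono_interval hr0.le hr.2.le hz.le ?_ hEint)
  exact (ae_restrict_iff' measurableSet_Ioc).2 (Eventually.of_forall fun t ht => hEnn t ht.1)

/-- A weighted bound on the solution yields a bound on its flux. -/
theorem abs_flux_le (h : IsRadialH1Solution N a u u') (hN : 2 ≤ N) {p σ z K : ℝ} (hp : 1 ≤ p)
    (ha : RadialMemLp N p a) (hσ : 0 < σ) (hσp : 2 * σ = N - N / p) (hz : z < 1) (hK : 0 ≤ K)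
    (hu : ∀ r ∈ Ioo 0 z, r ^ σ * |u r| ≤ K) {r : ℝ} (hr : r ∈ Ioo 0 z) :
    |r ^ (N - 1) * u' r|
      ≤ K * (r ^ σ * (1 / σ + ∫ t in (0:ℝ)..1, t ^ (N - 1) * |a t| ^ p)) := by
  have hr0 : 0 < r := hr.1
  have hr1 : r < 1 := hr.2.trans hz
  refine le_of_forall_pos_le_add fun η hη => ?_
  obtain ⟨s, hs, hsη⟩ := h.exists_abs_flux_lt hN hr0 hr1.le hη
  have hs0 : 0 < s := hs.1
  have hpow : IntervalIntegrable (fun t : ℝ => t ^ (σ - 1)) volume s r :=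
    intervalIntegral.intervalIntegrable_rpow' (by linarith)
  have hLp := ha.intervalIntegrable hs0.le hs.2.le hr1.le
  have hflux := h.abs_flux_sub_le hs0 hs.2.le hr1
    ((hpow.add (hLp.const_mul (r ^ σ))).const_mul K) (fun t ht => by
      have ht0 : 0 < t := hs0.trans ht.1
      have htσ : 0 < t ^ σ := by positivity
      have hut : |u t| ≤ K * t ^ (-σ) := by
        rw [Real.rpow_neg ht0.le, ← div_eq_mul_inv, le_div_iff₀ htσ, mul_comm]
        exact hu t ⟨ht0, ht.2.trans_lt hr.2⟩
      have hmono : t ^ σ ≤ r ^ σ := Real.rpow_le_rpow ht0.le ht.2 hσ.le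
      have hI : 0 ≤ t ^ (N - 1) * |a t| ^ p := by positivity
      have hpt := weighted_potential_le hN hp hσp ht0 (abs_nonneg (a t))
      rw [abs_mul, abs_mul, abs_of_pos (by positivity : 0 < t ^ (N - 1))]
      calc t ^ (N - 1) * |a t| * |u t| ≤ t ^ (N - 1) * |a t| * (K * t ^ (-σ)) :=
            mul_le_mul_of_nonneg_left hut (by positivity)
        _ = K * (t ^ (N - 1) * |a t| * t ^ (-σ)) := by ring
        _ ≤ K * (t ^ (σ - 1) + r ^ σ * (t ^ (N - 1) * |a t| ^ p)) :=
            mul_le_mul_of_nonneg_left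
              (hpt.trans (by gcongr)) hK)
  rw [intervalIntegral.integral_const_mul, intervalIntegral.integral_add hpow
    (hLp.const_mul _), intervalIntegral.integral_const_mul,
    integral_rpow (Or.inl (by linarith)), sub_add_cancel] at hflux
  have hsσ : 0 ≤ s ^ σ := by positivity
  have hrσ : 0 ≤ r ^ σ := by positivity
  have h1 : (r ^ σ - s ^ σ) / σ ≤ r ^ σ * (1 / σ) := by
    rw [mul_one_div]
    gcongr
    linarith
  have h2 := mul_le_mul_of_nonneg_left (ha.integral_le hs0.le hs.2.le hr1.le) hrσ
  have h3 := mul_le_mul_of_nonneg_left (add_le_add h1 h2) hK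
  have h4 := abs_sub_abs_le_abs_sub (r ^ (N - 1) * u' r) (s ^ (N - 1) * u' s)
  rw [mul_add (r ^ σ)]
  linarith

/-- Contraction estimate for the weighted supremum of a solution below one of its zeros. -/
theorem rpow_mul_abs_le (h : IsRadialH1Solution N a u u') (hN : 2 ≤ N) {p σ z K : ℝ}
    (hp : 1 ≤ p) (ha : RadialMemLp N p a) (hσ : 0 < σ) (hσp : 2 * σ = N - N / p)
    (hσN : (N : ℝ) - 2 < 2 * σ) (hz : z < 1) (huz : u z = 0) (hK : 0 ≤ K)
    (hu : ∀ r ∈ Ioo 0 z, r ^ σ * |u r| ≤ K) {r : ℝ} (hr : r ∈ Ioo 0 z) :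
    r ^ σ * |u r| ≤ K * ((1 / σ + ∫ t in (0:ℝ)..1, t ^ (N - 1) * |a t| ^ p)
      * (z ^ (2 * σ + 2 - N) / (2 * σ + 2 - N))) := by
  set C := 1 / σ + ∫ t in (0:ℝ)..1, t ^ (N - 1) * |a t| ^ p with hC
  have hr0 : 0 < r := hr.1
  have hrσ : 0 < r ^ σ := by positivity
  have hC0 : 0 ≤ C := by
    have : 0 ≤ ∫ t in (0:ℝ)..1, t ^ (N - 1) * |a t| ^ p :=
      intervalIntegral.integral_nonneg zero_le_one fun t ht => by
        have : 0 ≤ t := ht.1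
        positivity
    positivity
  have hsub : Icc r z ⊆ Ioo 0 1 := fun t ht => ⟨hr0.trans_le ht.1, ht.2.trans_lt hz⟩
  have hpow : IntervalIntegrable (fun t : ℝ => t ^ (2 * σ + 1 - N)) volume r z :=
    intervalIntegral.intervalIntegrable_rpow' (by linarith)
  have key := abs_sub_le_integral_of_abs_deriv_le (g := u) (g' := u')
    (φ := fun t => K * C / r ^ σ * t ^ (2 * σ + 1 - N)) hr.2.le
    (h.1.mono fun t ht => Ioo_subset_Ioc_self (hsub ht))
    (fun t ht => h.2.1 t (hsub (Ioo_subset_Icc_self ht)))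
    (((intervalIntegrable_iff_integrableOn_Icc_of_le hr.2.le).1 hpow).const_mul _)
    (fun t ht => by
      have ht0 : 0 < t := hr0.trans ht.1
      have hw : 0 < t ^ (N - 1) := by positivity
      have hmono : r ^ σ ≤ t ^ σ := Real.rpow_le_rpow hr0.le ht.1.le hσ.le
      have hfl := h.abs_flux_le hN hp ha hσ hσp hz hK hu ⟨ht0, ht.2⟩
      rw [← hC, abs_mul, abs_of_pos hw] at hfl
      have hsq : t ^ (2 * σ + 1 - N) = (t ^ σ) ^ 2 / t ^ (N - 1) := by
        rw [natPow_pred_eq_rpow hN, ← Real.rpow_natCast, ← Real.rpow_mul ht0.le,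
          ← Real.rpow_sub ht0]
        congr 1
        push_cast
        ring
      rw [hsq, div_mul_div_comm, le_div_iff₀ (by positivity)]
      have htσ : 0 ≤ t ^ σ := by positivity
      have hKC : 0 ≤ K * C := by positivity
      calc |u' t| * (r ^ σ * t ^ (N - 1)) = r ^ σ * (t ^ (N - 1) * |u' t|) := by ring
        _ ≤ r ^ σ * (K * (t ^ σ * C)) := mul_le_mul_of_nonneg_left hfl hrσ.le
        _ = K * C * (r ^ σ * t ^ σ) := by ring
        _ ≤ K * C * (t ^ σ * t ^ σ) := by gcongr
        _ = K * C * (t ^ σ) ^ 2 := by ring)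
  rw [huz, zero_sub, abs_neg, intervalIntegral.integral_const_mul,
    integral_rpow (Or.inl (by linarith)), div_mul_eq_mul_div, le_div_iff₀ hrσ] at key
  have e : 2 * σ + 1 - (N : ℝ) + 1 = 2 * σ + 2 - N := by ring
  rw [e] at key
  have hβ : 0 < 2 * σ + 2 - (N : ℝ) := by linarith
  rw [mul_comm, ← mul_assoc]
  refine key.trans ?_
  have : 0 ≤ r ^ (2 * σ + 2 - (N : ℝ)) := by positivity
  gcongr
  linarith

/-- A solution with a zero sufficiently close to the origin vanishes below that zero. -/
theorem eq_zero_of_mem_Ioo (h : IsRadialH1Solution N a u u') (hN : 2 ≤ N) {p σ z : ℝ}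
    (hp : 1 ≤ p) (ha : RadialMemLp N p a) (hσ : 0 < σ) (hσp : 2 * σ = N - N / p)
    (hσN : (N : ℝ) - 2 < 2 * σ) (hz : z < 1) (huz : u z = 0)
    (hsmall : (1 / σ + ∫ t in (0:ℝ)..1, t ^ (N - 1) * |a t| ^ p)
      * (z ^ (2 * σ + 2 - N) / (2 * σ + 2 - N)) < 1) {r : ℝ} (hr : r ∈ Ioo 0 z) : u r = 0 := by
  obtain ⟨B, hB⟩ := h.exists_rpow_mul_abs_le hN hσ hσN hz huz
  let f : ℝ → ℝ := fun t => t ^ σ * |u t|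
  have hbdd : BddAbove (f '' Ioo 0 z) := ⟨B, forall_mem_image.2 hB⟩
  have hle : ∀ t ∈ Ioo 0 z, f t ≤ sSup (f '' Ioo 0 z) := fun t ht =>
    le_csSup hbdd (mem_image_of_mem f ht)
  have hr0 : 0 < r := hr.1
  have hfr : 0 ≤ f r := by positivity
  have hK : 0 ≤ sSup (f '' Ioo 0 z) := hfr.trans (hle r hr)
  have hK' := csSup_le (Set.Nonempty.image f ⟨r, hr⟩) (forall_mem_image.2 fun t ht =>
    h.rpow_mul_abs_le hN hp ha hσ hσp hσN hz huz hK hle ht)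
  have hK0 : sSup (f '' Ioo 0 z) ≤ 0 := by nlinarith
  have hf0 : r ^ σ * |u r| ≤ 0 := (hle r hr).trans hK0
  have hrσ : 0 < r ^ σ := by positivity
  exact abs_nonpos_iff.1 (nonpos_of_mul_nonpos_right hf0 hrσ)

/-- Local uniqueness for the Cauchy problem, with explicit length of the interval. -/
theorem eq_zero_of_le_add (h : IsRadialH1Solution N a u u')
    (ha : IntegrableOn (fun t => t ^ (N - 1) * |a t|) (Ioo (0:ℝ) 1)) {s₀ δ x r : ℝ}
    (hs₀ : 0 < s₀)
    (hδ : (∫ t in (0:ℝ)..1, t ^ (N - 1) * |a t|) / s₀ ^ (N - 1) * δ < 1)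
    (hx : s₀ ≤ x) (hux : u x = 0) (hux' : u' x = 0) (hxr : x ≤ r) (hrδ : r ≤ x + δ)
    (hr : r < 1) : u r = 0 ∧ u' r = 0 := by
  set A := ∫ t in (0:ℝ)..1, t ^ (N - 1) * |a t| with hA
  have hx0 : 0 < x := hs₀.trans_le hx
  have hsub : Icc x r ⊆ Ioo 0 1 := fun t ht => ⟨hx0.trans_le ht.1, ht.2.trans_lt hr⟩
  have hcont : ContinuousOn (fun t => |u t|) (Icc x r) :=
    (h.1.mono fun t ht => Ioo_subset_Ioc_self (hsub ht)).abs
  obtain ⟨y, hy, hmax⟩ := isCompact_Icc.exists_isMaxOn (nonempty_Icc.2 hxr) hcont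
  have hle : ∀ t ∈ Icc x r, |u t| ≤ |u y| := fun t ht => hmax ht
  have hA01 : IntervalIntegrable (fun t => t ^ (N - 1) * |a t|) volume 0 1 :=
    (intervalIntegrable_iff_integrableOn_Ioo_of_le zero_le_one).2 ha
  have hA0 : 0 ≤ A := intervalIntegral.integral_nonneg zero_le_one fun t ht => by
    have : 0 ≤ t := ht.1
    positivity
  have hflux : ∀ t ∈ Icc x r, t ^ (N - 1) * |u' t| ≤ |u y| * A := by
    intro t ht
    have ht0 : 0 < t := hx0.trans_le ht.1
    have hint : IntervalIntegrable (fun t => t ^ (N - 1) * |a t|) volume x t :=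
      (intervalIntegrable_iff_integrableOn_Ioo_of_le ht.1).2
        (ha.mono_set (Ioo_subset_Ioo hx0.le (ht.2.trans hr.le)))
    have := h.abs_flux_sub_le hx0 ht.1 (ht.2.trans_lt hr) (hint.const_mul |u y|)
      (fun τ hτ => by
        have hτ0 : 0 < τ := hx0.trans hτ.1
        have := hle τ ⟨hτ.1.le, hτ.2.trans ht.2⟩
        rw [abs_mul, abs_mul, abs_of_pos (by positivity : 0 < τ ^ (N - 1)), mul_comm]
        gcongr)
    rw [hux', mul_zero, sub_zero, abs_mul, abs_of_pos (by positivity : 0 < t ^ (N - 1)),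
      intervalIntegral.integral_const_mul] at this
    refine this.trans (mul_le_mul_of_nonneg_left ?_ (abs_nonneg _))
    refine intervalIntegral.integral_mono_interval hx0.le ht.1 (ht.2.trans hr.le) ?_ hA01
    refine (ae_restrict_iff' measurableSet_Ioc).2 (Eventually.of_forall fun τ hτ => ?_)
    have : 0 < τ := hτ.1
    simp only [Pi.zero_apply]
    positivity
  have hderiv : ∀ t ∈ Ico x r, ‖u' t‖ ≤ |u y| * A / s₀ ^ (N - 1) := by
    intro t ht
    rw [Real.norm_eq_abs, le_div_iff₀ (by positivity), mul_comm]
    refine le_trans ?_ (hflux t (Ico_subset_Icc_self ht))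
    have : s₀ ≤ t := hx.trans ht.1
    gcongr
  have hmv := norm_image_sub_le_of_norm_deriv_le_segment'
    (fun t ht => (h.2.1 t (hsub ht)).hasDerivWithinAt) hderiv y hy
  rw [hux, sub_zero, Real.norm_eq_abs] at hmv
  have huy : |u y| = 0 := by
    have h1 : |u y| * A / s₀ ^ (N - 1) * (y - x) ≤ |u y| * (A / s₀ ^ (N - 1) * δ) := by
      rw [mul_div_assoc, mul_assoc]
      have : y - x ≤ δ := by linarith [hy.2]
      gcongr
    have h2 := abs_nonneg (u y)
    nlinarith
  have hr0 : 0 < r ^ (N - 1) := pow_pos (hx0.trans_le hxr) _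
  have hrr : r ∈ Icc x r := right_mem_Icc.2 hxr
  constructor
  · exact abs_nonpos_iff.1 ((hle r hrr).trans huy.le)
  · have := hflux r hrr
    rw [huy, zero_mul] at this
    exact abs_nonpos_iff.1 (nonpos_of_mul_nonpos_right this hr0)

/-- Unique continuation to the right of a point with vanishing Cauchy data. -/
theorem eq_zero_of_le (h : IsRadialH1Solution N a u u')
    (ha : IntegrableOn (fun t => t ^ (N - 1) * |a t|) (Ioo (0:ℝ) 1)) {s₀ r : ℝ}
    (hs₀ : 0 < s₀) (hu : u s₀ = 0) (hu' : u' s₀ = 0) (hr : s₀ ≤ r) (hr1 : r < 1) : u r = 0 := by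
  set L := (∫ t in (0:ℝ)..1, t ^ (N - 1) * |a t|) / s₀ ^ (N - 1) with hL
  have hL0 : 0 ≤ L := by
    have : 0 ≤ ∫ t in (0:ℝ)..1, t ^ (N - 1) * |a t| :=
      intervalIntegral.integral_nonneg zero_le_one fun t ht => by
        have : 0 ≤ t := ht.1
        positivity
    positivity
  have hδ0 : 0 < 1 / (L + 1) := by positivity
  have hδ : L * (1 / (L + 1)) < 1 := by
    rw [mul_one_div, div_lt_one (by positivity)]
    linarith
  have step : ∀ n : ℕ, ∀ r, s₀ ≤ r → r < 1 → r ≤ s₀ + n * (1 / (L + 1)) →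
      u r = 0 ∧ u' r = 0 := by
    intro n
    induction n with
    | zero =>
      intro r h1 _ h3
      obtain rfl : r = s₀ := le_antisymm (by simpa using h3) h1
      exact ⟨hu, hu'⟩
    | succ n ih =>
      intro r h1 h2 h3
      push_cast at h3
      have hxr : max s₀ (r - 1 / (L + 1)) ≤ r := max_le h1 (by linarith)
      have hx := ih (max s₀ (r - 1 / (L + 1))) (le_max_left _ _) (hxr.trans_lt h2)
        (max_le (by simp; positivity) (by linarith))
      exact h.eq_zero_of_le_add ha hs₀ hδ (le_max_left _ _) hx.1 hx.2 hxr
        (by linarith [le_max_right s₀ (r - 1 / (L + 1))]) h2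
  obtain ⟨n, hn⟩ := exists_nat_ge ((r - s₀) / (1 / (L + 1)))
  rw [div_le_iff₀ hδ0] at hn
  exact (step n r hr hr1 (by linarith)).1

/-- A solution vanishing near the origin is trivial. -/
theorem eq_zero_of_forall_mem_Ioo (h : IsRadialH1Solution N a u u')
    (ha : IntegrableOn (fun t => t ^ (N - 1) * |a t|) (Ioo (0:ℝ) 1)) {z : ℝ} (hz : 0 < z)
    (hz1 : z < 1) (hu : ∀ t ∈ Ioo 0 z, u t = 0) : ∀ r ∈ Ioc (0:ℝ) 1, u r = 0 := by
  have hmid : z / 2 ∈ Ioo 0 z := ⟨by positivity, by linarith⟩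
  have hderiv : u' (z / 2) = 0 := by
    have hev : u =ᶠ[nhds (z / 2)] fun _ => 0 :=
      Filter.mem_of_superset (Ioo_mem_nhds hmid.1 hmid.2) hu
    exact (h.2.1 _ ⟨hmid.1, hmid.2.trans hz1⟩).unique
      ((hasDerivAt_const (z / 2) (0:ℝ)).congr_of_eventuallyEq hev)
  have hopen : EqOn u (fun _ => 0) (Ioo (z / 2) 1) := fun r hr =>
    h.eq_zero_of_le ha hmid.1 (hu _ hmid) hderiv hr.1.le hr.2
  have hclosed : EqOn u (fun _ => 0) (Icc (z / 2) 1) :=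
    hopen.of_subset_closure (h.1.mono fun t ht => ⟨hmid.1.trans_le ht.1, ht.2⟩)
      continuousOn_const Ioo_subset_Icc_self
      (closure_Ioo (hmid.2.trans hz1).ne).ge
  intro r hr
  rcases lt_or_ge r (z / 2) with hlt | hge
  · exact hu r ⟨hr.1, hlt.trans hmid.2⟩
  · exact hclosed ⟨hge, hr.2⟩

end IsRadialH1Solution

/-- For `N ≥ 2`, `p > N/2`, `M > 0` there is `ε = ε(N,p,M) > 0` such that for
every radial `a ∈ L^p(B_1)` with `‖a‖_{L^p(B_1)} ≤ M` and every nontrivial radial `H^1`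
solution `u` of `Δu + a u = 0` in `B_1`, every zero `z ∈ (0,1]` of `u` satisfies `z > ε`. -/
theorem stmt14 (N : ℕ) (hN : 2 ≤ N) (p M : ℝ) (hp : (N : ℝ) / 2 < p) (hM : 0 < M) :
    ∃ ε : ℝ, 0 < ε ∧
      ∀ a : ℝ → ℝ, Measurable a → RadialMemLp N p a → radialLpNorm N p a ≤ M →
        ∀ u u' : ℝ → ℝ, IsRadialH1Solution N a u u' → (∃ r ∈ Ioc (0:ℝ) 1, u r ≠ 0) →
          ∀ z ∈ Ioc (0:ℝ) 1, u z = 0 → ε < z := by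
  have hN2 : (2:ℝ) ≤ N := by exact_mod_cast hN
  have hp1 : 1 < p := by linarith
  have hp0 : 0 < p := by linarith
  have hNp : (N : ℝ) / p < 2 := by
    rw [div_lt_iff₀ hp0]
    linarith
  obtain ⟨σ, hσp⟩ : ∃ σ : ℝ, 2 * σ = N - N / p := ⟨(N - N / p) / 2, by ring⟩
  have hσ : 0 < σ := by linarith
  have hσN : (N : ℝ) - 2 < 2 * σ := by linarith
  have hβ : 0 < 2 * σ + 2 - (N : ℝ) := by linarith
  have hC : 0 < 1 / σ + M ^ p / omegaN N := by
    have := omegaN_pos hN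
    positivity
  set C := 1 / σ + M ^ p / omegaN N with hCdef
  set β := 2 * σ + 2 - (N : ℝ) with hβdef
  refine ⟨min (1 / 2) ((β / (2 * C)) ^ β⁻¹), by positivity, ?_⟩
  intro a hm ha hM u u' h hnt z hz huz
  by_contra! hle
  have hz0 : 0 < z := hz.1
  have hz1 : z < 1 := (hle.trans (min_le_left _ _)).trans_lt (by norm_num)
  have hzβ : z ^ β ≤ β / (2 * C) := by
    have := Real.rpow_le_rpow hz0.le (hle.trans (min_le_right _ _)) hβ.le
    rwa [Real.rpow_inv_rpow (by positivity) hβ.ne'] at this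
  have hI := integral_le_of_radialLpNorm_le hN hp0 hM
  have hsmall : (1 / σ + ∫ t in (0:ℝ)..1, t ^ (N - 1) * |a t| ^ p) * (z ^ β / β) < 1 := by
    calc (1 / σ + ∫ t in (0:ℝ)..1, t ^ (N - 1) * |a t| ^ p) * (z ^ β / β)
        ≤ C * (β / (2 * C) / β) := by
          rw [hCdef]
          gcongr
      _ = 1 / 2 := by field_simp
      _ < 1 := by norm_num
  obtain ⟨r, hr, hur⟩ := hnt
  exact hur (h.eq_zero_of_forall_mem_Ioo (ha.integrableOn_weight_mul_abs hp1.le hm) hz0 hz1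
    (fun t ht => h.eq_zero_of_mem_Ioo hN hp1.le ha hσ hσp hσN hz1 huz hsmall ht) r hr)
end
end
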